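/- Let G be a dihedral group of order 2n, where n ≥ 4 is even (so D(G) = 3n/2). Then for every k ∈ ℕ, k·D(G) + 2 ≤ ρ_{2k+1}(G) ≤ ⌊(2k+1)·D(G)/2⌋ - 1. -/

import Mathlib

/-- A multiset over a group is a *product-one sequence* if its terms can be
ordered so that their product is `1`. -/
def IsProductOne {G : Type*} [Group G] (S : Multiset G) : Prop :=
  ∃ l : List G, (l : Multiset G) = S ∧ l.prod = 1

/-- A product-one sequence is *minimal* (an atom of `B(G)`) if it is non-trivial
and cannot be written as a concatenation of two non-trivial product-one
sequences. -/
def IsMinimalProductOne {G : Type*} [Group G] (S : Multiset G) : Prop :=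
  S ≠ 0 ∧ IsProductOne S ∧
    ∀ T₁ T₂ : Multiset G, T₁ ≠ 0 → T₂ ≠ 0 → IsProductOne T₁ → IsProductOne T₂ →
      S ≠ T₁ + T₂

/-- The large Davenport constant `D(G)`: the maximal length of a minimal
product-one sequence over `G`. -/
noncomputable def DavenportLarge (G : Type*) [Group G] : ℕ :=
  sSup {m | ∃ S : Multiset G, IsMinimalProductOne S ∧ Multiset.card S = m}

/-- `k ∈ L(a)`: the product-one sequence `a` is a concatenation of `k` minimal
product-one sequences. -/
def HasLength {G : Type*} [Group G] (a : Multiset G) (k : ℕ) : Prop :=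
  ∃ f : Fin k → Multiset G, (∀ i, IsMinimalProductOne (f i)) ∧ (∑ i, f i) = a

/-- `U_k(G)`: the union of all sets of lengths `L(a)` with `k ∈ L(a)`. -/
def UnionLengths (G : Type*) [Group G] (k : ℕ) : Set ℕ :=
  {m | ∃ a : Multiset G, IsProductOne a ∧ HasLength a k ∧ HasLength a m}

/-- `ρ_k(G) = sup U_k(G)`. -/
noncomputable def rhoK (G : Type*) [Group G] (k : ℕ) : ℕ :=
  sSup (UnionLengths G k)

/-- `λ_k(G) = min U_k(G)`. -/
noncomputable def lambdaK (G : Type*) [Group G] (k : ℕ) : ℕ :=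
  sInf (UnionLengths G k)


namespace DihRho

section Engine
variable {Z : Type*} [AddCommGroup Z] [DecidableEq Z] {ι : Type*}

/-- Set of subset sums of a multiset. -/
def subs (X : Multiset Z) : Finset Z := (X.powerset.map Multiset.sum).toFinset

lemma mem_subs {X : Multiset Z} {z : Z} : z ∈ subs X ↔ ∃ N, N ≤ X ∧ N.sum = z := by
  simp [subs]

lemma mem_subs_cons {X : Multiset Z} {x z : Z} :
    z ∈ subs (x ::ₘ X) ↔ z ∈ subs X ∨ z - x ∈ subs X := by
  simp only [subs, Multiset.powerset_cons, Multiset.map_add, Multiset.mem_toFinset,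
    Multiset.mem_add, Multiset.map_map]
  constructor
  · rintro (h | h)
    · exact Or.inl h
    · right
      obtain ⟨N, hN, rfl⟩ := Multiset.mem_map.1 h
      exact Multiset.mem_map.2 ⟨N, hN, by simp⟩
  · rintro (h | h)
    · exact Or.inl h
    · right
      obtain ⟨N, hN, h⟩ := Multiset.mem_map.1 h
      exact Multiset.mem_map.2 ⟨N, hN, by simp [h]⟩

lemma zero_mem_subs (X : Multiset Z) : (0 : Z) ∈ subs X :=
  mem_subs.2 ⟨0, Multiset.zero_le _, by simp⟩

lemma subs_zero : subs (0 : Multiset Z) = {0} := by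
  ext z; simp [subs, eq_comm]

lemma subs_mono {X Y : Multiset Z} (h : X ≤ Y) : subs X ⊆ subs Y := by
  intro z hz
  obtain ⟨N, hN, rfl⟩ := mem_subs.1 hz
  exact mem_subs.2 ⟨N, hN.trans h, rfl⟩

variable [Fintype Z]

/-- Stabilizer of a finite set. -/
def stb (Y : Finset Z) : Finset Z := Finset.univ.filter (fun z => ∀ t ∈ Y, t + z ∈ Y)

lemma mem_stb {Y : Finset Z} {z : Z} : z ∈ stb Y ↔ ∀ t ∈ Y, t + z ∈ Y := by simp [stb]

lemma zero_mem_stb (Y : Finset Z) : (0 : Z) ∈ stb Y := mem_stb.2 (by simp)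

lemma stb_back {Y : Finset Z} {z t : Z} (hz : z ∈ stb Y) (h : t + z ∈ Y) : t ∈ Y := by
  have himg : Y.image (fun t => t + z) = Y := by
    apply Finset.eq_of_subset_of_card_le
    · intro y hy
      obtain ⟨t, ht, rfl⟩ := Finset.mem_image.1 hy
      exact mem_stb.1 hz t ht
    · rw [Finset.card_image_of_injective _ (add_left_injective z)]
  rw [← himg] at h
  obtain ⟨s, hs, hst⟩ := Finset.mem_image.1 h
  have : s = t := add_right_cancel hst
  rwa [← this]

lemma neg_mem_stb {Y : Finset Z} {z : Z} (hz : z ∈ stb Y) : -z ∈ stb Y :=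
  mem_stb.2 fun t ht => stb_back hz (by simpa using ht)

lemma add_mem_stb {Y : Finset Z} {z w : Z} (hz : z ∈ stb Y) (hw : w ∈ stb Y) : z + w ∈ stb Y :=
  mem_stb.2 fun t ht => by
    rw [← add_assoc]; exact mem_stb.1 hw _ (mem_stb.1 hz _ ht)

lemma sum_mem_stb {Y : Finset Z} {X : Multiset Z} (h : ∀ x ∈ X, x ∈ stb Y) : X.sum ∈ stb Y := by
  induction X using Multiset.induction_on with
  | empty => simpa using zero_mem_stb Y
  | cons a s ih =>
    rw [Multiset.sum_cons]
    exact add_mem_stb (h a (by simp)) (ih fun x hx => h x (by simp [hx]))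

lemma stb_cons {X : Multiset Z} {x z : Z} (hz : z ∈ stb (subs X)) : z ∈ stb (subs (x ::ₘ X)) := by
  refine mem_stb.2 fun t ht => ?_
  rw [mem_subs_cons] at ht ⊢
  rcases ht with ht | ht
  · exact Or.inl (mem_stb.1 hz _ ht)
  · right
    have := mem_stb.1 hz _ ht
    rwa [show t + z - x = t - x + z by abel]

lemma stb_add {X Y : Multiset Z} {z : Z} (hz : z ∈ stb (subs X)) : z ∈ stb (subs (X + Y)) := by
  induction Y using Multiset.induction_on with
  | empty => simpa using hz
  | cons a s ih => rw [Multiset.add_cons]; exact stb_cons ih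

lemma stb_mono {X Y : Multiset Z} (h : X ≤ Y) {z : Z} (hz : z ∈ stb (subs X)) :
    z ∈ stb (subs Y) := by
  obtain ⟨U, rfl⟩ := Multiset.le_iff_exists_add.1 h
  exact stb_add hz

lemma subs_stable {X O : Multiset Z} (h : ∀ x ∈ O, x ∈ stb (subs X)) : subs (X + O) = subs X := by
  induction O using Multiset.induction_on with
  | empty => simp
  | cons a s ih =>
    have ih' := ih fun x hx => h x (by simp [hx])
    rw [Multiset.add_cons]
    ext z
    rw [mem_subs_cons, ih']
    constructor
    · rintro (h1 | h1)
      · exact h1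
      · simpa using mem_stb.1 (h a (by simp)) _ h1
    · exact Or.inl

lemma card_subs_cons_lt {X : Multiset Z} {x : Z} (hx : x ∉ stb (subs X)) :
    (subs X).card < (subs (x ::ₘ X)).card := by
  apply Finset.card_lt_card
  refine ⟨subs_mono (Multiset.le_cons_self _ _), fun hsub => hx (mem_stb.2 fun t ht => ?_)⟩
  exact hsub (mem_subs_cons.2 (Or.inr (by simpa using ht)))

lemma card_subs_cons_two {X : Multiset Z} {x z : Z} (hx : x ∉ stb (subs X)) (hz0 : z ≠ 0)
    (hz : z ∈ stb (subs X)) :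
    (subs X).card + 2 ≤ (subs (x ::ₘ X)).card := by
  have hsub : subs X ⊆ subs (x ::ₘ X) := subs_mono (Multiset.le_cons_self _ _)
  have : ∃ t ∈ subs (x ::ₘ X), t ∉ subs X := by
    by_contra hcon
    push Not at hcon
    have h1 := card_subs_cons_lt hx
    have h2 : (subs (x ::ₘ X)).card ≤ (subs X).card := Finset.card_le_card hcon
    omega
  obtain ⟨t, ht, htn⟩ := this
  have ht2 : t + z ∈ subs (x ::ₘ X) := mem_stb.1 (stb_cons hz) _ ht
  have htn2 : t + z ∉ subs X := fun h => htn (stb_back hz h)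
  have h3 : insert t (insert (t + z) (subs X)) ⊆ subs (x ::ₘ X) := by
    intro y hy
    simp only [Finset.mem_insert] at hy
    rcases hy with rfl | rfl | hy
    · exact ht
    · exact ht2
    · exact hsub hy
  have h4 := Finset.card_le_card h3
  rw [Finset.card_insert_of_notMem, Finset.card_insert_of_notMem htn2] at h4
  · omega
  · simp only [Finset.mem_insert, not_or]
    exact ⟨fun h => hz0 (by simpa using h), htn⟩

lemma greedy [DecidableEq ι] (g : ℕ) (f : ι → Z) : ∀ (N : ℕ) (X : Multiset ι) (W0 : Multiset Z),
    X.card = N → (g = 1 ∨ (g = 2 ∧ ∃ z, z ≠ 0 ∧ z ∈ stb (subs W0))) →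
    ∃ W O : Multiset ι, X = W + O ∧
      (subs W0).card + g * W.card ≤ (subs (W0 + W.map f)).card ∧
      ∀ x ∈ O, f x ∈ stb (subs (W0 + W.map f)) := by
  intro N
  induction N with
  | zero =>
    intro X W0 hX _
    refine ⟨0, 0, ?_, ?_, ?_⟩
    · simpa using hX
    · simp
    · simp
  | succ N ih =>
    intro X W0 hX hg
    by_cases hall : ∀ x ∈ X, f x ∈ stb (subs W0)
    · exact ⟨0, X, by simp, by simp, by simpa using hall⟩
    · push Not at hall
      obtain ⟨x, hxX, hx⟩ := hall
      obtain ⟨X', rfl⟩ := Multiset.exists_cons_of_mem hxX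
      have hcard : X'.card = N := by simpa using hX
      have hgrow : (subs W0).card + g ≤ (subs (f x ::ₘ W0)).card := by
        rcases hg with rfl | ⟨rfl, z, hz0, hz⟩
        · exact card_subs_cons_lt hx
        · exact card_subs_cons_two hx hz0 hz
      obtain ⟨W, O, rfl, hc, hO⟩ := ih X' (f x ::ₘ W0) hcard (by
        rcases hg with rfl | ⟨rfl, z, hz0, hz⟩
        · exact Or.inl rfl
        · exact Or.inr ⟨rfl, z, hz0, stb_cons hz⟩)
      have heq : f x ::ₘ W0 + W.map f = W0 + (x ::ₘ W).map f := by
        rw [Multiset.map_cons, Multiset.add_cons, Multiset.cons_add]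
      refine ⟨x ::ₘ W, O, by simp, ?_, ?_⟩
      · rw [← heq, Multiset.card_cons]
        linarith [hc, hgrow, Nat.mul_succ g W.card]
      · rw [← heq]; exact hO

/-- zero-sum free -/
def ZSF (X : Multiset Z) : Prop := ∀ N, N ≤ X → N ≠ 0 → N.sum ≠ 0

lemma ZSF.mono {X Y : Multiset Z} (h : ZSF Y) (hle : X ≤ Y) : ZSF X :=
  fun N hN h0 => h N (hN.trans hle) h0

lemma zsf_grow {X Y : Multiset Z} (h : ZSF (X + Y)) :
    (subs X).card + Y.card ≤ (subs (X + Y)).card := by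
  induction Y using Multiset.induction_on with
  | empty => simp
  | cons a s ih =>
    rw [Multiset.add_cons] at h ⊢
    have ih' := ih (h.mono (Multiset.le_cons_self _ _))
    have : a ∉ stb (subs (X + s)) := by
      intro ha
      have h1 : (0 : Z) - a ∈ subs (X + s) := by
        have := mem_stb.1 (neg_mem_stb ha) 0 (zero_mem_subs _)
        simpa using this
      obtain ⟨N, hN, hs⟩ := mem_subs.1 h1
      refine h (a ::ₘ N) (Multiset.cons_le_cons a hN) (Multiset.cons_ne_zero) ?_
      rw [Multiset.sum_cons, hs]; abel
    have h2 := card_subs_cons_lt this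
    rw [Multiset.card_cons]; omega

lemma zsf_card {X : Multiset Z} (h : ZSF X) : X.card + 1 ≤ (subs X).card := by
  have := zsf_grow (X := 0) (Y := X) (by simpa using h)
  rw [subs_zero] at this
  simp at this
  omega

lemma le_add_split [DecidableEq ι] {N A B : Multiset ι} (h : N ≤ A + B) :
    ∃ NA NB, NA ≤ A ∧ NB ≤ B ∧ N = NA + NB := by
  refine ⟨N ∩ A, N - A, Multiset.inter_le_right, ?_, ?_⟩
  · rw [tsub_le_iff_left]; exact h
  · ext x
    rw [Multiset.count_add, Multiset.count_inter, Multiset.count_sub]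
    omega

lemma le_map_lift {κ : Type*} {f : ι → κ} {X : Multiset ι} : ∀ {N : Multiset κ}, N ≤ X.map f →
    ∃ M, M ≤ X ∧ M.map f = N := by
  classical
  induction X using Multiset.induction_on with
  | empty => intro N hN; exact ⟨0, le_rfl, by simpa [eq_comm] using hN⟩
  | cons a s ih =>
    intro N hN
    rw [Multiset.map_cons] at hN
    by_cases ha : f a ∈ N
    · obtain ⟨N', rfl⟩ := Multiset.exists_cons_of_mem ha
      obtain ⟨M, hM, rfl⟩ := ih ((Multiset.cons_le_cons_iff _).1 hN)
      exact ⟨a ::ₘ M, Multiset.cons_le_cons a hM, by simp⟩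
    · obtain ⟨M, hM, rfl⟩ := ih ((Multiset.le_cons_of_notMem ha).1 hN)
      exact ⟨M, hM.trans (Multiset.le_cons_self _ _), rfl⟩

/-- Signed zero sum -/
def SZ (X : Multiset Z) : Prop := ∃ N, N ≤ X ∧ X.sum = N.sum + N.sum

lemma double_bound [DecidableEq ι] (f : ι → Z) (A : Multiset Z) (C : Multiset ι) (hA : ZSF A)
    (hC : ∀ D, D ≤ C → D ≠ 0 → ∀ Y, Y ≤ A → ¬ SZ (Y + D.map f)) :
    2 ^ C.card * (A.card + 1) ≤ (subs (A + C.map f)).card := by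
  induction C using Multiset.induction_on with
  | empty => simpa using zsf_card hA
  | cons c s ih =>
    have ih' := ih fun D hD => hC D (hD.trans (Multiset.le_cons_self _ _))
    rw [Multiset.map_cons, Multiset.add_cons]
    set X := A + s.map f with hX
    have hdisj : Disjoint (subs X) ((subs X).image (fun t => t + f c)) := by
      rw [Finset.disjoint_left]
      intro t ht ht2
      obtain ⟨P, hP, rfl⟩ := mem_subs.1 ht
      obtain ⟨u, hu, hu2⟩ := Finset.mem_image.1 ht2
      obtain ⟨Q, hQ, rfl⟩ := mem_subs.1 hu
      have hle : (P - Q) + (Q - P) ≤ X := by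
        rw [Multiset.le_iff_count] at *
        intro a
        have h1 := hP a
        have h2 := hQ a
        rw [Multiset.count_add, Multiset.count_sub, Multiset.count_sub]
        omega
      have hsum : (P - Q).sum + Q.sum = (Q - P).sum + P.sum := by
        rw [← Multiset.sum_add, ← Multiset.sum_add]
        congr 1
        ext a
        simp only [Multiset.count_add, Multiset.count_sub]
        omega
      obtain ⟨Y, D', hY, hD', hYD⟩ := le_add_split hle
      obtain ⟨D, hD, rfl⟩ := le_map_lift hD'
      refine hC (c ::ₘ D) (Multiset.cons_le_cons c hD) Multiset.cons_ne_zero Y hY ?_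
      rw [Multiset.map_cons, Multiset.add_cons, ← hYD]
      refine ⟨P - Q, ?_, ?_⟩
      · exact (Multiset.le_add_right _ _).trans (Multiset.le_cons_self _ _)
      · rw [Multiset.sum_cons, Multiset.sum_add]
        have e1 : (P - Q).sum = (Q - P).sum + P.sum - Q.sum := by rw [← hsum]; abel
        have e2 : f c = P.sum - Q.sum := by rw [← hu2]; abel
        rw [e2, e1]; abel
    have hsub : subs X ∪ (subs X).image (fun t => t + f c) ⊆ subs (f c ::ₘ X) := by
      intro t ht
      rcases Finset.mem_union.1 ht with ht | ht
      · exact mem_subs_cons.2 (Or.inl ht)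
      · obtain ⟨u, hu, rfl⟩ := Finset.mem_image.1 ht
        exact mem_subs_cons.2 (Or.inr (by simpa using hu))
    have h1 := Finset.card_le_card hsub
    rw [Finset.card_union_of_disjoint hdisj,
      Finset.card_image_of_injective _ (add_left_injective (f c))] at h1
    rw [Multiset.card_cons, pow_succ]
    nlinarith

end Engine
end DihRho


namespace DihRho

section Seq
variable {n : ℕ}
open DihedralGroup

/-- The sequence with rotations `A` and reflections `B`. -/
def mk (A B : Multiset (ZMod n)) : Multiset (DihedralGroup n) := A.map r + B.map sr

lemma exists_mk (S : Multiset (DihedralGroup n)) : ∃ A B, S = mk A B := by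
  induction S using Multiset.induction_on with
  | empty => exact ⟨0, 0, by simp [mk]⟩
  | cons a s ih =>
    obtain ⟨A, B, rfl⟩ := ih
    cases a with
    | r i => exact ⟨i ::ₘ A, B, by simp [mk]⟩
    | sr i => exact ⟨A, i ::ₘ B, by simp [mk]⟩

lemma mk_add (A B C D : Multiset (ZMod n)) : mk (A + C) (B + D) = mk A B + mk C D := by
  simp only [mk, Multiset.map_add]; abel

lemma card_mk (A B : Multiset (ZMod n)) : (mk A B).card = A.card + B.card := by simp [mk]

lemma mk_inj {A B C D : Multiset (ZMod n)} (h : mk A B = mk C D) : A = C ∧ B = D := by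
  have key : ∀ A B : Multiset (ZMod n),
      (mk A B).filterMap (fun g => match g with | r i => some i | sr _ => none) = A ∧
      (mk A B).filterMap (fun g => match g with | r _ => none | sr i => some i) = B := by
    intro A B
    constructor
    · induction A using Multiset.induction_on with
      | empty =>
        induction B using Multiset.induction_on with
        | empty => simp [mk]
        | cons b s ih => simpa [mk] using ih
      | cons a s ih => simpa [mk] using ih
    · induction B using Multiset.induction_on with
      | empty =>
        induction A using Multiset.induction_on with
        | empty => simp [mk]
        | cons b s ih => simpa [mk] using ih
      | cons a s ih => simpa [mk] using ih
  constructor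
  · rw [← (key A B).1, h, (key C D).1]
  · rw [← (key A B).2, h, (key C D).2]

lemma mk_eq_zero {A B : Multiset (ZMod n)} : mk A B = 0 ↔ A = 0 ∧ B = 0 := by
  simp [mk]

lemma list_form (l : List (DihedralGroup n)) : ∃ A1 A2 B1 B2 : Multiset (ZMod n),
    (l : Multiset (DihedralGroup n)) = mk (A1 + A2) (B1 + B2) ∧ (B1 + B2 = 0 → A2 = 0) ∧
    ((B1.card = B2.card ∧ l.prod = r (A1.sum - A2.sum + (B1.sum - B2.sum))) ∨
     (B1.card = B2.card + 1 ∧ l.prod = sr (A1.sum - A2.sum + (B1.sum - B2.sum)))) := by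
  induction l with
  | nil => exact ⟨0, 0, 0, 0, by simp [mk], by simp, Or.inl ⟨rfl, by simp⟩⟩
  | cons a l ih =>
    obtain ⟨A1, A2, B1, B2, h1, h2, h3⟩ := ih
    rw [← Multiset.cons_coe, h1]
    cases a with
    | r i =>
      rcases h3 with ⟨h3, h4⟩ | ⟨h3, h4⟩
      · refine ⟨i ::ₘ A1, A2, B1, B2, by simp [mk], h2, Or.inl ⟨h3, ?_⟩⟩
        rw [List.prod_cons, h4, r_mul_r, Multiset.sum_cons]; congr 1; ring
      · refine ⟨A1, i ::ₘ A2, B1, B2, by simp [mk], ?_, Or.inr ⟨h3, ?_⟩⟩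
        · intro h
          have := congrArg Multiset.card h
          rw [Multiset.card_add, h3] at this
          simp at this
        rw [List.prod_cons, h4, r_mul_sr, Multiset.sum_cons]; congr 1; ring
    | sr i =>
      rcases h3 with ⟨h3, h4⟩ | ⟨h3, h4⟩
      · refine ⟨A1, A2, i ::ₘ B1, B2, by simp [mk], by simp, Or.inr ⟨by simp [h3], ?_⟩⟩
        rw [List.prod_cons, h4, sr_mul_r, Multiset.sum_cons]; congr 1; ring
      · refine ⟨A1, A2, B1, i ::ₘ B2, by simp [mk], by simp, Or.inl ⟨by simp [h3], ?_⟩⟩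
        rw [List.prod_cons, h4, sr_mul_sr, Multiset.sum_cons]; congr 1; ring

/-- some ordering has product g -/
def HP {G : Type*} [Group G] (S : Multiset G) (g : G) : Prop :=
  ∃ l : List G, (l : Multiset G) = S ∧ l.prod = g

lemma HP.add {G : Type*} [Group G] {S T : Multiset G} {g h : G} (h1 : HP S g) (h2 : HP T h) :
    HP (S + T) (g * h) := by
  obtain ⟨l, rfl, rfl⟩ := h1
  obtain ⟨l', rfl, rfl⟩ := h2
  exact ⟨l ++ l', by simp, by simp⟩

lemma po_add {G : Type*} [Group G] {S T : Multiset G} (h1 : IsProductOne S)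
    (h2 : IsProductOne T) : IsProductOne (S + T) := by
  have := HP.add (g := 1) (h := 1) h1 h2
  rw [mul_one] at this
  exact this

lemma hp_r (A : Multiset (ZMod n)) : HP (mk A 0) (r A.sum) := by
  induction A using Multiset.induction_on with
  | empty => exact ⟨[], by simp [mk], by simp⟩
  | cons a s ih =>
    have h1 : HP ({r a} : Multiset (DihedralGroup n)) (r a) := ⟨[r a], by simp, by simp⟩
    have := h1.add ih
    rw [r_mul_r] at this
    rw [Multiset.sum_cons]
    convert this using 1
    simp [mk]

lemma hp_sr (b : ZMod n) : HP (mk 0 {b}) (sr b) := ⟨[sr b], by simp [mk], by simp⟩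

lemma exists_pairing : ∀ {B1 B2 : Multiset (ZMod n)}, B1.card = B2.card →
    ∃ P : Multiset (ZMod n × ZMod n), P.map Prod.fst = B1 ∧ P.map Prod.snd = B2 := by
  intro B1
  induction B1 using Multiset.induction_on with
  | empty =>
    intro B2 h
    refine ⟨0, by simp, ?_⟩
    rw [Multiset.card_zero] at h
    rw [Multiset.card_eq_zero.1 h.symm, Multiset.map_zero]
  | cons b s ih =>
    intro B2 h
    have : B2 ≠ 0 := by rintro rfl; simp at h
    obtain ⟨c, hc⟩ := Multiset.exists_mem_of_ne_zero this
    obtain ⟨t, rfl⟩ := Multiset.exists_cons_of_mem hc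
    obtain ⟨P, h1, h2⟩ := ih (B2 := t) (by simpa using h)
    exact ⟨(b, c) ::ₘ P, by simp [h1], by simp [h2]⟩

lemma po_rot {A : Multiset (ZMod n)} (h : A.sum = 0) : IsProductOne (mk A 0) := by
  have := hp_r A
  rw [h, ← one_def] at this
  exact this

/-- reflections of a multiset of pairs -/
def refl' (P : Multiset (ZMod n × ZMod n)) : Multiset (ZMod n) :=
  P.map Prod.fst + P.map Prod.snd

/-- difference of a pair -/
def dl (p : ZMod n × ZMod n) : ZMod n := p.1 - p.2

lemma sum_dl (P : Multiset (ZMod n × ZMod n)) :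
    (P.map dl).sum = (P.map Prod.fst).sum - (P.map Prod.snd).sum := by
  unfold dl
  rw [Multiset.sum_map_sub]

lemma hp_pairs (P : Multiset (ZMod n × ZMod n)) : HP (mk 0 (refl' P)) (r (P.map dl).sum) := by
  induction P using Multiset.induction_on with
  | empty => exact ⟨[], by simp [mk, refl'], by simp⟩
  | cons p P ih =>
    have h := ((hp_sr p.2).add (hp_sr p.1)).add ih
    rw [sr_mul_sr, r_mul_r] at h
    rw [Multiset.map_cons, Multiset.sum_cons]
    change HP _ (r (p.1 - p.2 + _))
    convert h using 1
    simp only [mk, refl', Multiset.map_cons, Multiset.map_add, Multiset.map_zero,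
      Multiset.map_singleton, zero_add, ← Multiset.singleton_add]
    abel

/-- core criterion -/
lemma po_of {A1 A2 B1 B2 : Multiset (ZMod n)} (h : B1.card = B2.card) (h0 : B1 ≠ 0)
    (hs : A1.sum - A2.sum + (B1.sum - B2.sum) = 0) : IsProductOne (mk (A1 + A2) (B1 + B2)) := by
  obtain ⟨b, hb⟩ := Multiset.exists_mem_of_ne_zero h0
  obtain ⟨t, rfl⟩ := Multiset.exists_cons_of_mem hb
  have : B2 ≠ 0 := by rintro rfl; simp at h
  obtain ⟨c, hc⟩ := Multiset.exists_mem_of_ne_zero this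
  obtain ⟨t', rfl⟩ := Multiset.exists_cons_of_mem hc
  obtain ⟨P, h1, h2⟩ := exists_pairing (B1 := t) (B2 := t') (by simpa using h)
  have hh := ((((hp_r A1).add (hp_sr c)).add (hp_r A2)).add (hp_sr b)).add (hp_pairs P)
  rw [r_mul_sr, sr_mul_r, sr_mul_sr, r_mul_r, sum_dl, h1, h2] at hh
  simp only [Multiset.sum_cons] at hs
  have e : b - (c - A1.sum + A2.sum) + (t.sum - t'.sum) = 0 := by linear_combination hs
  rw [e, ← one_def] at hh
  have e2 : mk (A1 + A2) ((b ::ₘ t) + (c ::ₘ t')) =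
      mk A1 0 + mk 0 {c} + mk A2 0 + mk 0 {b} + mk 0 (refl' P) := by
    simp only [mk, refl', h1, h2, Multiset.map_cons, Multiset.map_add, Multiset.map_zero,
      Multiset.map_singleton, zero_add, ← Multiset.singleton_add]
    abel
  rw [e2]
  exact hh

lemma po_elim {A B : Multiset (ZMod n)} (h : IsProductOne (mk A B)) : ∃ A1 A2 B1 B2,
    A = A1 + A2 ∧ B = B1 + B2 ∧ B1.card = B2.card ∧ A1.sum - A2.sum + (B1.sum - B2.sum) = 0 ∧
    (B = 0 → A2 = 0) := by
  obtain ⟨l, hl, hp⟩ := h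
  obtain ⟨A1, A2, B1, B2, h1, h2, h3⟩ := list_form l
  obtain ⟨rfl, rfl⟩ := mk_inj (hl.symm.trans h1)
  rcases h3 with ⟨h3, h4⟩ | ⟨h3, h4⟩
  · refine ⟨A1, A2, B1, B2, rfl, rfl, h3, ?_, h2⟩
    rw [hp, one_def] at h4
    exact (r.inj h4).symm
  · rw [hp, one_def] at h4
    cases h4

lemma po_rot_iff {A : Multiset (ZMod n)} : IsProductOne (mk A 0) ↔ A.sum = 0 := by
  refine ⟨fun h => ?_, po_rot⟩
  obtain ⟨A1, A2, B1, B2, rfl, hB, h1, h2, h3⟩ := po_elim h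
  have hB' : B1 = 0 ∧ B2 = 0 := by simpa [eq_comm] using hB
  obtain ⟨rfl, rfl⟩ := hB'
  rw [h3 rfl] at h2 ⊢
  simpa using h2

/-- solution with fixed halves -/
def Sol (A B1 B2 : Multiset (ZMod n)) : Prop :=
  B1.card = B2.card ∧ ∃ A2, A2 ≤ A ∧ A.sum + (B1.sum - B2.sum) = A2.sum + A2.sum

lemma Sol.symm {A B1 B2 : Multiset (ZMod n)} (h : Sol A B1 B2) : Sol A B2 B1 := by
  obtain ⟨h1, A2, h2, h3⟩ := h
  obtain ⟨A1, rfl⟩ := Multiset.le_iff_exists_add.1 h2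
  refine ⟨h1.symm, A1, Multiset.le_add_left _ _, ?_⟩
  rw [Multiset.sum_add] at *
  linear_combination -h3

lemma Sol.po {A B1 B2 : Multiset (ZMod n)} (h : Sol A B1 B2) (h0 : B1 ≠ 0) :
    IsProductOne (mk A (B1 + B2)) := by
  obtain ⟨h1, A2, h2, h3⟩ := h
  obtain ⟨A1, rfl⟩ := Multiset.le_iff_exists_add.1 h2
  rw [add_comm A2]
  refine po_of h1 h0 ?_
  rw [Multiset.sum_add] at *
  linear_combination h3

lemma exists_sol {A B : Multiset (ZMod n)} (h : IsProductOne (mk A B)) :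
    ∃ B1 B2, B = B1 + B2 ∧ Sol A B1 B2 := by
  obtain ⟨A1, A2, B1, B2, rfl, rfl, h1, h2, h3⟩ := po_elim h
  refine ⟨B1, B2, rfl, h1, A2, Multiset.le_add_left _ _, ?_⟩
  rw [Multiset.sum_add]
  linear_combination h2

lemma Sol.sz {A : Multiset (ZMod n)} {P : Multiset (ZMod n × ZMod n)}
    (h : Sol A (P.map Prod.fst) (P.map Prod.snd)) : SZ (A + P.map dl) := by
  obtain ⟨h1, A2, h2, h3⟩ := h
  refine ⟨A2, h2.trans (Multiset.le_add_right _ _), ?_⟩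
  rw [Multiset.sum_add, sum_dl, h3]

lemma po_pairs {A : Multiset (ZMod n)} {P : Multiset (ZMod n × ZMod n)} (h0 : P ≠ 0)
    (h : SZ (A + P.map dl)) : IsProductOne (mk A (refl' P)) := by
  classical
  obtain ⟨N, hN, hs⟩ := h
  obtain ⟨A2, N2, hA2, hN2, rfl⟩ := le_add_split hN
  obtain ⟨P2, hP2, rfl⟩ := le_map_lift hN2
  obtain ⟨A1, rfl⟩ := Multiset.le_iff_exists_add.1 hA2
  obtain ⟨P1, rfl⟩ := Multiset.le_iff_exists_add.1 hP2
  have e : mk (A2 + A1) (refl' (P2 + P1)) =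
    mk (A1 + A2) ((P1.map Prod.fst + P2.map Prod.snd) + (P1.map Prod.snd + P2.map Prod.fst)) := by
    rw [add_comm A2]
    congr 1
    simp only [refl', Multiset.map_add]
    abel
  rw [e]
  apply po_of
  · simp
  · intro hh
    apply h0
    have : (P1.map Prod.fst + P2.map Prod.snd).card = 0 := by rw [hh]; rfl
    simp at this
    simp [this]
  · simp only [Multiset.map_add, Multiset.sum_add, sum_dl] at hs ⊢
    linear_combination hs

lemma refl'_add (P Q : Multiset (ZMod n × ZMod n)) : refl' (P + Q) = refl' P + refl' Q := by
  simp only [refl', Multiset.map_add]; abel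

lemma card_refl' (P : Multiset (ZMod n × ZMod n)) : (refl' P).card = 2 * P.card := by
  simp [refl', two_mul]

lemma no_split {A B A' B' : Multiset (ZMod n)} (h : IsMinimalProductOne (mk (A + A') (B + B')))
    (h1 : IsProductOne (mk A B)) (h2 : IsProductOne (mk A' B')) (h3 : A + B ≠ 0)
    (h4 : A' + B' ≠ 0) : False := by
  refine h.2.2 (mk A B) (mk A' B') ?_ ?_ h1 h2 (mk_add _ _ _ _)
  · intro h5; apply h3; rw [mk_eq_zero] at h5; simp [h5]
  · intro h5; apply h4; rw [mk_eq_zero] at h5; simp [h5]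

end Seq
end DihRho


namespace DihRho

section Core
variable {n m : ℕ} [NeZero n]

/-- doubling -/
def dbl (x : ZMod n) : ZMod n := x + x

lemma mu_add (hn : n = 2 * m) : (m : ZMod n) + (m : ZMod n) = 0 := by
  have : ((2 * m : ℕ) : ZMod n) = 0 := by rw [← hn]; simp
  push_cast at this
  linear_combination this

lemma mu_ne (hn : n = 2 * m) (hm : 2 ≤ m) : (m : ZMod n) ≠ 0 := by
  intro h
  rw [ZMod.natCast_eq_zero_iff] at h
  have := Nat.le_of_dvd (by omega) h
  omega

lemma dbl_zero (hn : n = 2 * m) {x : ZMod n} (h : x + x = 0) : x = 0 ∨ x = (m : ZMod n) := by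
  have hx : ((x.val : ℕ) : ZMod n) = x := ZMod.natCast_zmod_val x
  have hlt := ZMod.val_lt x
  have h2 : ((x.val + x.val : ℕ) : ZMod n) = 0 := by push_cast; rw [hx]; exact h
  rw [ZMod.natCast_eq_zero_iff] at h2
  obtain ⟨c, hc⟩ := h2
  have hc2 : c < 2 := by
    by_contra hcon
    have : n * 2 ≤ n * c := Nat.mul_le_mul_left _ (by omega)
    omega
  interval_cases c
  · left; rw [← hx]; have : x.val = 0 := by omega
    rw [this]; simp
  · right; rw [← hx]; congr 1; omega

/-- the set of doubles -/
def EE (n : ℕ) [NeZero n] : Finset (ZMod n) := Finset.univ.image dbl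

lemma card_EE (hn : n = 2 * m) (hm : 2 ≤ m) : (EE n).card ≤ m := by
  have h := Finset.mul_card_image_le_card (s := (Finset.univ : Finset (ZMod n))) (f := dbl) 2 (by
    intro a ha
    obtain ⟨x, -, rfl⟩ := Finset.mem_image.1 ha
    have : ({x, x + (m : ZMod n)} : Finset (ZMod n)) ⊆ Finset.univ.filter (fun y => dbl y = dbl x) := by
      intro y hy
      simp only [Finset.mem_insert, Finset.mem_singleton] at hy
      rcases hy with rfl | rfl
      · simp
      · refine Finset.mem_filter.2 ⟨Finset.mem_univ _, ?_⟩
        unfold dbl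
        linear_combination mu_add hn
    refine le_trans ?_ (Finset.card_le_card this)
    rw [Finset.card_pair]
    intro h
    exact mu_ne hn hm (by simpa using h))
  rw [Finset.card_univ, ZMod.card] at h
  unfold EE
  omega

lemma card_pre (hn : n = 2 * m) (K : Finset (ZMod n)) (U : Finset (ZMod n))
    (h : ∀ x ∈ U, dbl x ∈ K) : U.card ≤ 2 * K.card := by
  apply Finset.card_le_mul_card_image_of_maps_to h
  intro b hb
  by_cases hne : (U.filter (fun a => dbl a = b)).Nonempty
  · obtain ⟨x, hx⟩ := hne
    have : U.filter (fun a => dbl a = b) ⊆ {x, x + (m : ZMod n)} := by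
      intro y hy
      simp only [Finset.mem_filter] at hx hy
      have : (y - x) + (y - x) = 0 := by
        have e1 := hx.2; have e2 := hy.2
        unfold dbl at e1 e2
        linear_combination e2 - e1
      rcases dbl_zero hn this with h | h
      · simp [sub_eq_zero.1 h]
      · have : y = x + (m : ZMod n) := by linear_combination h
        simp [this]
    exact (Finset.card_le_card this).trans Finset.card_le_two
  · rw [Finset.not_nonempty_iff_eq_empty] at hne
    rw [hne]; simp

/-- subset sums of doubles -/
def TT (X : Multiset (ZMod n)) : Finset (ZMod n) := subs (X.map dbl)

lemma sum_dbl (N : Multiset (ZMod n)) : (N.map dbl).sum = N.sum + N.sum := by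
  unfold dbl
  rw [Multiset.sum_map_add, Multiset.map_id']

lemma mem_TT {X : Multiset (ZMod n)} {z : ZMod n} :
    z ∈ TT X ↔ ∃ N, N ≤ X ∧ z = N.sum + N.sum := by
  unfold TT
  rw [mem_subs]
  constructor
  · rintro ⟨N, hN, rfl⟩
    obtain ⟨M, hM, rfl⟩ := le_map_lift hN
    exact ⟨M, hM, sum_dbl M⟩
  · rintro ⟨N, hN, rfl⟩
    exact ⟨N.map dbl, Multiset.map_le_map hN, sum_dbl N⟩

lemma SZ_iff {X : Multiset (ZMod n)} : SZ X ↔ X.sum ∈ TT X := mem_TT.symm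

lemma TT_sub (X : Multiset (ZMod n)) : TT X ⊆ EE n := by
  intro z hz
  obtain ⟨N, -, rfl⟩ := mem_TT.1 hz
  exact Finset.mem_image.2 ⟨N.sum, Finset.mem_univ _, rfl⟩

lemma stb_sub {X : Multiset (ZMod n)} : stb (TT X) ⊆ TT X := by
  intro z hz
  have := mem_stb.1 hz 0 (zero_mem_subs _)
  simpa using this

lemma card_TT (hn : n = 2 * m) (hm : 2 ≤ m) (X : Multiset (ZMod n)) : (TT X).card ≤ m :=
  (Finset.card_le_card (TT_sub X)).trans (card_EE hn hm)

lemma card_stb_le {X : Multiset (ZMod n)} : (stb (TT X)).card ≤ (TT X).card :=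
  Finset.card_le_card stb_sub

lemma one_le_stb {X : Multiset (ZMod n)} : 1 ≤ (stb (TT X)).card :=
  Finset.card_pos.2 ⟨0, zero_mem_stb _⟩

lemma card_TT_ne (hn : n = 2 * m) (hm : 2 ≤ m) {X : Multiset (ZMod n)} (h : TT X ≠ EE n) :
    (TT X).card + (stb (TT X)).card ≤ m := by
  have : ∃ e ∈ EE n, e ∉ TT X := by
    by_contra hcon
    push Not at hcon
    exact h (Finset.Subset.antisymm (TT_sub X) hcon)
  obtain ⟨e, he, he2⟩ := this
  have hd : Disjoint (TT X) ((stb (TT X)).image (fun z => e + z)) := by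
    rw [Finset.disjoint_left]
    intro t ht ht2
    obtain ⟨z, hz, rfl⟩ := Finset.mem_image.1 ht2
    exact he2 (stb_back hz ht)
  have hs : TT X ∪ ((stb (TT X)).image (fun z => e + z)) ⊆ EE n := by
    apply Finset.union_subset (TT_sub X)
    intro t ht
    obtain ⟨z, hz, rfl⟩ := Finset.mem_image.1 ht
    obtain ⟨x, -, rfl⟩ := Finset.mem_image.1 he
    obtain ⟨y, -, rfl⟩ := Finset.mem_image.1 (TT_sub X (stb_sub hz))
    exact Finset.mem_image.2 ⟨x + y, Finset.mem_univ _, by unfold dbl; ring⟩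
  have h1 := Finset.card_le_card hs
  rw [Finset.card_union_of_disjoint hd, Finset.card_image_of_injective _ (add_right_injective e)] at h1
  exact h1.trans (card_EE hn hm)

lemma TT_stable {X R : Multiset (ZMod n)} (h : ∀ x ∈ R, dbl x ∈ stb (TT X)) :
    TT (X + R) = TT X := by
  unfold TT at *
  rw [Multiset.map_add]
  apply subs_stable
  intro y hy
  obtain ⟨x, hx, rfl⟩ := Multiset.mem_map.1 hy
  exact h x hx

lemma stb_TT_mono {X Y : Multiset (ZMod n)} (h : X ≤ Y) {z : ZMod n} (hz : z ∈ stb (TT X)) :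
    z ∈ stb (TT Y) := stb_mono (Multiset.map_le_map h) hz

lemma dbl_sum_mem {X V : Multiset (ZMod n)} (h : ∀ x ∈ V, dbl x ∈ stb (TT X)) :
    V.sum + V.sum ∈ stb (TT X) := by
  rw [← sum_dbl]
  apply sum_mem_stb
  intro y hy
  obtain ⟨x, hx, rfl⟩ := Multiset.mem_map.1 hy
  exact h x hx

lemma rest_sz {X R V : Multiset (ZMod n)} (hR : ∀ x ∈ R, dbl x ∈ stb (TT X))
    (hV : ∀ x ∈ V, dbl x ∈ stb (TT X)) (h : SZ (X + (R + V))) (hs : V.sum ∈ stb (TT X)) :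
    SZ (X + R) := by
  rw [SZ_iff] at *
  have hRV : ∀ x ∈ R + V, dbl x ∈ stb (TT X) := by
    intro x hx
    rcases Multiset.mem_add.1 hx with h | h
    · exact hR x h
    · exact hV x h
  rw [TT_stable hRV] at h
  rw [TT_stable hR]
  refine stb_back hs ?_
  simp only [Multiset.sum_add] at h ⊢
  rw [add_assoc]
  exact h

lemma core {WA OA : Multiset (ZMod n)} {WP OP : Multiset (ZMod n × ZMod n)}
    (hat : IsMinimalProductOne (mk (WA + OA) (refl' (WP + OP)))) (hWP : WP ≠ 0)
    (hsz : SZ (WA + OA + (WP + OP).map dl))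
    (hOA : ∀ x ∈ OA, dbl x ∈ stb (TT (WA + WP.map dl)))
    (hOP : ∀ p ∈ OP, dbl (dl p) ∈ stb (TT (WA + WP.map dl))) :
    ZSF OA ∧ ∀ D, D ≤ OP → D ≠ 0 → ∀ Y, Y ≤ OA → ¬ SZ (Y + D.map dl) := by
  have key : ∀ D, D ≤ OP → ∀ Y, Y ≤ OA → Y + D.map dl ≠ 0 → IsProductOne (mk Y (refl' D)) →
      (Y + D.map dl).sum ∈ stb (TT (WA + WP.map dl)) → False := by
    intro D hD Y hY hne hpo hsum
    obtain ⟨D', rfl⟩ := Multiset.le_iff_exists_add.1 hD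
    obtain ⟨Y', rfl⟩ := Multiset.le_iff_exists_add.1 hY
    have h1 : SZ (WA + WP.map dl + (Y' + D'.map dl)) := by
      refine rest_sz (V := Y + D.map dl) ?_ ?_ ?_ hsum
      · intro x hx
        rcases Multiset.mem_add.1 hx with h | h
        · exact hOA x (Multiset.mem_add.2 (Or.inr h))
        · obtain ⟨p, hp, rfl⟩ := Multiset.mem_map.1 h
          exact hOP p (Multiset.mem_add.2 (Or.inr hp))
      · intro x hx
        rcases Multiset.mem_add.1 hx with h | h
        · exact hOA x (Multiset.mem_add.2 (Or.inl h))
        · obtain ⟨p, hp, rfl⟩ := Multiset.mem_map.1 h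
          exact hOP p (Multiset.mem_add.2 (Or.inl hp))
      · convert hsz using 1
        simp only [Multiset.map_add]; abel
    have h2 : IsProductOne (mk (WA + Y') (refl' (WP + D'))) := by
      apply po_pairs
      · intro h; exact hWP (by simp at h; exact h.1)
      · convert h1 using 1
        simp only [Multiset.map_add]; abel
    refine no_split (A := Y) (B := refl' D) (A' := WA + Y') (B' := refl' (WP + D')) ?_ hpo h2 ?_ ?_
    · convert hat using 2
      · abel
      · rw [← refl'_add]; congr 1; abel
    · intro h
      apply hne
      have h3 : Y = 0 ∧ D = 0 := by simpa [refl'] using h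
      simp [h3]
    · intro h
      apply hWP
      have h3 := congrArg Multiset.card h
      simp [card_refl'] at h3
      exact h3.2.1
  constructor
  · intro N hN hN0 hNs
    refine key 0 (Multiset.zero_le _) N hN (by simpa using hN0) ?_ ?_
    · simp only [refl', Multiset.map_zero, add_zero]
      exact po_rot hNs
    · simp only [Multiset.map_zero, add_zero, hNs]
      exact zero_mem_stb _
  · intro D hD hD0 Y hY hS
    refine key D hD Y hY ?_ (po_pairs hD0 hS) ?_
    · intro h
      apply hD0
      simp at h; exact h.2
    · obtain ⟨N, hN, hs⟩ := hS
      rw [hs]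
      apply dbl_sum_mem
      intro x hx
      rcases Multiset.mem_add.1 (Multiset.mem_of_le hN hx) with h | h
      · exact hOA x (Multiset.mem_of_le hY h)
      · obtain ⟨p, hp, rfl⟩ := Multiset.mem_map.1 h
        exact hOP p (Multiset.mem_of_le hD hp)

lemma bound_in (hn : n = 2 * m) {OA X : Multiset (ZMod n)} {OP : Multiset (ZMod n × ZMod n)}
    (h1 : ZSF OA) (h2 : ∀ D, D ≤ OP → D ≠ 0 → ∀ Y, Y ≤ OA → ¬ SZ (Y + D.map dl))
    (hOA : ∀ x ∈ OA, dbl x ∈ stb (TT X)) (hOP : ∀ p ∈ OP, dbl (dl p) ∈ stb (TT X)) :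
    2 ^ OP.card * (OA.card + 1) ≤ 2 * (stb (TT X)).card := by
  refine (double_bound dl OA OP h1 h2).trans ?_
  apply card_pre hn
  intro x hx
  obtain ⟨N, hN, rfl⟩ := mem_subs.1 hx
  apply dbl_sum_mem
  intro x hx
  rcases Multiset.mem_add.1 (Multiset.mem_of_le hN hx) with h | h
  · exact hOA x h
  · obtain ⟨p, hp, rfl⟩ := Multiset.mem_map.1 h
    exact hOP p hp

/-- greedy for doubles -/
lemma greedyD {ι : Type*} [DecidableEq ι] (g : ℕ) (f : ι → ZMod n) (X : Multiset ι)
    (W0 : Multiset (ZMod n)) (hg : g = 1 ∨ (g = 2 ∧ 2 ≤ (stb (TT W0)).card)) :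
    ∃ W O : Multiset ι, X = W + O ∧ (TT W0).card + g * W.card ≤ (TT (W0 + W.map f)).card ∧
      ∀ x ∈ O, dbl (f x) ∈ stb (TT (W0 + W.map f)) := by
  have := greedy g (fun x => dbl (f x)) X.card X (W0.map dbl) rfl (by
    rcases hg with h | ⟨h, h2⟩
    · exact Or.inl h
    · right
      refine ⟨h, ?_⟩
      obtain ⟨z, hz, hz0⟩ := Finset.exists_mem_ne h2 0
      exact ⟨z, hz0, hz⟩)
  obtain ⟨W, O, h1, h2, h3⟩ := this
  refine ⟨W, O, h1, ?_, ?_⟩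
  · unfold TT; rw [Multiset.map_add, Multiset.map_map]; exact h2
  · unfold TT; rw [Multiset.map_add, Multiset.map_map]; exact h3

end Core
end DihRho


namespace DihRho

section Atoms
variable {n m : ℕ} [NeZero n]

lemma r0_bound {A : Multiset (ZMod n)} (h : IsMinimalProductOne (mk A 0)) : A.card ≤ n := by
  have hs := po_rot_iff.1 h.2.1
  have h0 : A ≠ 0 := by
    rintro rfl; exact h.1 (by simp [mk])
  obtain ⟨x, hx⟩ := Multiset.exists_mem_of_ne_zero h0
  obtain ⟨A', rfl⟩ := Multiset.exists_cons_of_mem hx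
  have hz : ZSF A' := by
    intro N hN hN0 hNs
    obtain ⟨R, rfl⟩ := Multiset.le_iff_exists_add.1 hN
    rw [← Multiset.add_cons] at h
    refine no_split (A := N) (B := 0) (A' := x ::ₘ R) (B' := 0) (by simpa using h) (po_rot hNs)
      (po_rot ?_) (by simpa using hN0) (by simp)
    rw [← Multiset.add_cons, Multiset.sum_add, hNs, zero_add] at hs
    exact hs
  have h1 := zsf_card hz
  have h2 := Finset.card_le_univ (subs A')
  rw [ZMod.card] at h2
  rw [Multiset.card_cons]
  omega

lemma zsf_const {O : Multiset (ZMod n)} (h : ZSF O) (hc : n ≤ O.card + 1) {x y : ZMod n}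
    (hx : x ∈ O) (hy : y ∈ O) : x = y := by
  by_contra hne
  obtain ⟨O', rfl⟩ := Multiset.exists_cons_of_mem hx
  have hy' : y ∈ O' := by
    rcases Multiset.mem_cons.1 hy with h | h
    · exact absurd h.symm hne
    · exact h
  obtain ⟨R, rfl⟩ := Multiset.exists_cons_of_mem hy'
  have e : x ::ₘ y ::ₘ R = (x ::ₘ {y}) + R := by simp
  rw [e] at h
  have hg := zsf_grow h
  have hx0 : x ≠ 0 := by
    have := h {x} (by simp) (by simp)
    simpa using this
  have hy0 : y ≠ 0 := by
    have := h {y} (by simp) (by simp)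
    simpa using this
  have hxy : x + y ≠ 0 := by
    have := h (x ::ₘ {y}) (Multiset.le_add_right _ _) (by simp)
    simpa using this
  have h4 : 4 ≤ (subs (x ::ₘ {y})).card := by
    have hsub : ({0, x, y, x + y} : Finset (ZMod n)) ⊆ subs (x ::ₘ {y}) := by
      intro z hz
      simp only [Finset.mem_insert, Finset.mem_singleton] at hz
      rw [mem_subs]
      rcases hz with rfl | rfl | rfl | rfl
      · exact ⟨0, Multiset.zero_le _, by simp⟩
      · exact ⟨{z}, by simp, by simp⟩
      · exact ⟨{z}, by simp, by simp⟩
      · exact ⟨x ::ₘ {y}, le_rfl, by simp⟩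
    have hc4 : ({0, x, y, x + y} : Finset (ZMod n)).card = 4 := by
      rw [Finset.card_insert_of_notMem, Finset.card_insert_of_notMem, Finset.card_pair]
      · simpa using hx0
      · simp [hne, hy0]
      · simp [hx0.symm, hy0.symm, hxy.symm]
    rw [← hc4]
    exact Finset.card_le_card hsub
  have h2 := Finset.card_le_univ (subs (x ::ₘ {y} + R))
  rw [ZMod.card] at h2
  simp only [Multiset.card_cons] at hc
  omega

lemma r1_main (hn : n = 2 * m) (hm : 2 ≤ m) {A : Multiset (ZMod n)} {p : ZMod n × ZMod n}
    (h : IsMinimalProductOne (mk A (refl' {p}))) (hsz : SZ (A + ({p} : Multiset _).map dl)) :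
    ∃ W O, A = W + O ∧ ZSF O ∧ W.card + 1 ≤ m ∧ O.card + 1 ≤ 2 * m := by
  obtain ⟨W, O, rfl, h2, h3⟩ := greedyD 1 (fun x => x) A (({p} : Multiset (ZMod n × ZMod n)).map dl)
    (Or.inl rfl)
  have e : (({p} : Multiset (ZMod n × ZMod n)).map dl) + W.map (fun x => x) =
    W + (({p} : Multiset (ZMod n × ZMod n)).map dl) := by simp [add_comm]
  rw [e] at h2 h3
  have hc := core (WA := W) (OA := O) (WP := {p}) (OP := 0) (by simpa using h) (by simp)
    (by simpa using hsz) h3 (by simp)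
  have hb := bound_in hn hc.1 hc.2 h3 (by simp)
  have h4 := card_TT hn hm (W + (({p} : Multiset (ZMod n × ZMod n)).map dl))
  have h5 := card_stb_le (X := W + (({p} : Multiset (ZMod n × ZMod n)).map dl))
  have h6 : 1 ≤ (TT (({p} : Multiset (ZMod n × ZMod n)).map dl)).card :=
    Finset.card_pos.2 ⟨0, zero_mem_subs _⟩
  refine ⟨W, O, rfl, hc.1, ?_, ?_⟩
  · omega
  · rw [Multiset.card_zero, pow_zero, one_mul] at hb
    omega

lemma r1_U2 (hn : n = 2 * m) (hm : 2 ≤ m) {A : Multiset (ZMod n)} {p : ZMod n × ZMod n}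
    (h : IsMinimalProductOne (mk A (refl' {p}))) (hsz : SZ (A + ({p} : Multiset _).map dl))
    (hA : A.card + 2 = 3 * m) : ∃ g : ZMod n, g + g ≠ 0 ∧ A = Multiset.replicate (3 * m - 2) g := by
  obtain ⟨W, O, hWO, hZ, hW, hO⟩ := r1_main hn hm h hsz
  have hcard : A.card = W.card + O.card := by rw [hWO]; simp
  have hOc : O.card = 2 * m - 1 := by omega
  have hO0 : O ≠ 0 := by rintro rfl; simp at hOc; omega
  obtain ⟨g, hg⟩ := Multiset.exists_mem_of_ne_zero hO0
  have hOg : O = Multiset.replicate (2 * m - 1) g :=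
    Multiset.eq_replicate.2 ⟨hOc, fun b hb => zsf_const hZ (by omega) hb hg⟩
  have hle : Multiset.replicate (m - 1) g ≤ A := by
    rw [hWO, hOg]
    refine le_trans ?_ (Multiset.le_add_left _ _)
    exact Multiset.replicate_le_replicate g |>.2 (by omega)
  obtain ⟨R, hR⟩ := Multiset.le_iff_exists_add.1 hle
  have hRc : R.card = 2 * m - 1 := by
    have := congrArg Multiset.card hR
    simp at this; omega
  have hTT : TT (Multiset.replicate (m - 1) g + ({p} : Multiset _).map dl) = EE n := by
    apply Finset.eq_of_subset_of_card_le (TT_sub _)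
    refine (card_EE hn hm).trans ?_
    have hz : ZSF ((Multiset.replicate (m - 1) g).map dbl) := by
      intro N hN hN0 hNs
      obtain ⟨M, hM, rfl⟩ := le_map_lift hN
      rw [sum_dbl, ← Multiset.sum_add] at hNs
      refine hZ (M + M) ?_ ?_ hNs
      · have hMc := Multiset.card_le_card hM
        have : M = Multiset.replicate M.card g := Multiset.eq_replicate.2
          ⟨rfl, fun b hb => Multiset.eq_of_mem_replicate (Multiset.mem_of_le hM hb)⟩
        rw [hOg, this, ← Multiset.replicate_add]
        simp at hMc
        exact Multiset.replicate_le_replicate g |>.2 (by omega)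
      · intro h; apply hN0
        simp at h; simp [h]
    have h1 := zsf_card hz
    simp only [Multiset.card_map, Multiset.card_replicate] at h1
    have h2 : subs ((Multiset.replicate (m - 1) g).map dbl) ⊆
        TT (Multiset.replicate (m - 1) g + ({p} : Multiset _).map dl) := by
      apply subs_mono
      exact Multiset.map_le_map (Multiset.le_add_right _ _)
    have h3 := Finset.card_le_card h2
    omega
  have hst : ∀ x ∈ R, dbl x ∈ stb (TT (Multiset.replicate (m - 1) g + ({p} : Multiset _).map dl)) := by
    intro x hx
    rw [hTT, mem_stb]
    intro t ht
    obtain ⟨y, -, rfl⟩ := Finset.mem_image.1 ht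
    exact Finset.mem_image.2 ⟨y + x, Finset.mem_univ _, by unfold dbl; ring⟩
  have hc := core (WA := Multiset.replicate (m - 1) g) (OA := R) (WP := {p}) (OP := 0)
    (by rw [← hR]; simpa using h) (by simp) (by rw [← hR]; simpa using hsz) hst (by simp)
  have hgR : g ∈ R := by
    have h1 : Multiset.count g A = (m - 1) + Multiset.count g R := by rw [hR]; simp
    have h2 : Multiset.count g A = Multiset.count g W + (2 * m - 1) := by rw [hWO, hOg]; simp
    apply Multiset.count_pos.1
    omega
  have hRg : R = Multiset.replicate (2 * m - 1) g :=
    Multiset.eq_replicate.2 ⟨hRc, fun b hb => zsf_const hc.1 (by omega) hb hgR⟩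
  refine ⟨g, ?_, ?_⟩
  · have := hZ (Multiset.replicate 2 g) (by
      rw [hOg]; exact Multiset.replicate_le_replicate g |>.2 (by omega)) (by simp)
    simpa [two_mul] using this
  · rw [hR, hRg, ← Multiset.replicate_add]
    congr 1; omega

lemma r1_U3 (hn : n = 2 * m) (hm : 3 ≤ m) {A : Multiset (ZMod n)} {p : ZMod n × ZMod n}
    (h : IsMinimalProductOne (mk A (refl' {p}))) (hsz : SZ (A + ({p} : Multiset _).map dl))
    (hA : A.card + 3 = 3 * m) (hbal : ∀ x, A.count x = A.count (-x)) : False := by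
  obtain ⟨W, O, hWO, hZ, hW, hO⟩ := r1_main hn (by omega) h hsz
  have hcard : A.card = W.card + O.card := by rw [hWO]; simp
  have hle : O ≤ A := by rw [hWO]; exact Multiset.le_add_left _ _
  have hpt : ∀ x : ZMod n, O.count x + O.count (-x) ≤ A.count x + (if x = (m : ZMod n) then 1 else 0) := by
    intro x
    have h1 := Multiset.count_le_of_le x hle
    have h2 := Multiset.count_le_of_le (-x) hle
    rw [← hbal x] at h2
    by_cases hx : x ∈ O
    swap
    · rw [← Multiset.count_eq_zero] at hx; omega
    by_cases hx' : -x ∈ O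
    swap
    · rw [← Multiset.count_eq_zero] at hx'; omega
    have hx0 : x ≠ 0 := by
      have := hZ {x} (by simpa using hx) (by simp)
      simpa using this
    by_cases hxx : x = -x
    · have : x = (m : ZMod n) := by
        rcases dbl_zero hn (x := x) (by nth_rewrite 2 [hxx]; ring) with h | h
        · exact absurd h hx0
        · exact h
      rw [if_pos this, ← hxx]
      have h1c : O.count x ≤ 1 := by
        by_contra hcon
        refine hZ (Multiset.replicate 2 x) ?_ (by simp) ?_
        · exact Multiset.le_count_iff_replicate_le.1 (by omega)
        · rw [Multiset.sum_replicate, two_nsmul]; nth_rewrite 2 [hxx]; ring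
      omega
    · exfalso
      refine hZ (x ::ₘ {-x}) ?_ (by simp) (by simp)
      rw [Multiset.le_iff_count]
      intro a
      rw [Multiset.count_cons, Multiset.count_singleton]
      have e1 := Multiset.count_pos.2 hx
      have e2 := Multiset.count_pos.2 hx'
      split_ifs with ha hb hb
      · exact absurd (ha.symm.trans hb).symm hxx
      · subst ha; omega
      · subst hb; omega
      · omega
  have hsum := Finset.sum_le_sum (fun x (_ : x ∈ (Finset.univ : Finset (ZMod n))) => hpt x)
  rw [Finset.sum_add_distrib, Finset.sum_add_distrib] at hsum
  have hneg : ∑ x : ZMod n, O.count (-x) = ∑ x : ZMod n, O.count x :=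
    Equiv.sum_comp (Equiv.neg (ZMod n)) (fun x => O.count x)
  rw [hneg, Multiset.sum_count_eq_card (by simp), Multiset.sum_count_eq_card (by simp)] at hsum
  simp at hsum
  omega

end Atoms
end DihRho


namespace DihRho

section Two
variable {n m : ℕ} [NeZero n]

lemma po_double (b : ZMod n) : IsProductOne (mk 0 ({b} + {b})) := by
  refine Sol.po (A := 0) (B1 := {b}) (B2 := {b}) ⟨rfl, 0, le_rfl, by simp⟩ (by simp)

lemma no_common {A B1 B2 : Multiset (ZMod n)} (h : IsMinimalProductOne (mk A (B1 + B2)))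
    (hs : Sol A B1 B2) (hr : 2 ≤ B1.card) {b : ZMod n} (h1 : b ∈ B1) (h2 : b ∈ B2) : False := by
  obtain ⟨C1, rfl⟩ := Multiset.exists_cons_of_mem h1
  obtain ⟨C2, rfl⟩ := Multiset.exists_cons_of_mem h2
  have hne : C1 ≠ 0 := by rintro rfl; simp at hr
  obtain ⟨hc, A2, hA2, hsum⟩ := hs
  have hs' : Sol A C1 C2 := by
    refine ⟨by simpa using hc, A2, hA2, ?_⟩
    simp only [Multiset.sum_cons] at hsum
    linear_combination hsum
  refine no_split (A := 0) (B := {b} + {b}) (A' := A) (B' := C1 + C2) ?_ (po_double b)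
    (hs'.po hne) (by simp) ?_
  · convert h using 2
    · simp
    · simp only [← Multiset.singleton_add]; abel
  · intro h
    apply hne
    simp at h; exact h.2.1

lemma dup_opp {A B1 B2 : Multiset (ZMod n)} {b d : ZMod n}
    (h : IsMinimalProductOne (mk A ((b ::ₘ b ::ₘ B1) + (d ::ₘ B2))))
    (hs : Sol A (b ::ₘ b ::ₘ B1) (d ::ₘ B2)) (hbd : (b - d) + (b - d) = 0) : False := by
  obtain ⟨hc, A2, hA2, hsum⟩ := hs
  simp only [Multiset.card_cons] at hc
  have hs' : Sol A (d ::ₘ B1) B2 := by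
    refine ⟨?_, A2, hA2, ?_⟩
    · simp only [Multiset.card_cons]; omega
    · simp only [Multiset.sum_cons] at hsum ⊢
      linear_combination hsum - hbd
  refine no_split (A := 0) (B := {b} + {b}) (A' := A) (B' := (d ::ₘ B1) + B2) ?_ (po_double b)
    (hs'.po (by simp)) (by simp) (by simp)
  convert h using 2
  · simp
  · simp only [← Multiset.singleton_add]; abel

lemma two_same {A B1 B2 : Multiset (ZMod n)} {x x' y y' : ZMod n}
    (h : IsMinimalProductOne (mk A ((x ::ₘ x' ::ₘ B1) + (y ::ₘ y' ::ₘ B2))))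
    (hs : Sol A (x ::ₘ x' ::ₘ B1) (y ::ₘ y' ::ₘ B2)) (hne : B1 ≠ 0)
    (he : x - y + (x' - y') = 0) : False := by
  obtain ⟨hc, A2, hA2, hsum⟩ := hs
  simp only [Multiset.card_cons] at hc
  have hs' : Sol A B1 B2 := by
    refine ⟨by omega, A2, hA2, ?_⟩
    · simp only [Multiset.sum_cons] at hsum ⊢
      linear_combination hsum - he
  have hs2 : Sol (0 : Multiset (ZMod n)) {x, x'} {y, y'} := by
    refine ⟨by simp, 0, le_rfl, ?_⟩
    simp
    linear_combination he
  refine no_split (A := 0) (B := {x, x'} + {y, y'}) (A' := A) (B' := B1 + B2) ?_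
    (hs2.po (by simp)) (hs'.po hne) (by simp) ?_
  · convert h using 2
    · simp
    · simp only [Multiset.insert_eq_cons, ← Multiset.singleton_add]; abel
  · intro h
    apply hne
    simp at h; exact h.2.1

lemma arith_ii (m sW sO rW rO h y f g : ℕ) (hm : 2 ≤ m) (h1 : sW + 2 ≤ y) (h2 : 1 ≤ h)
    (h3 : h ≤ y) (h4 : sO + 1 ≤ 2 * h) (h5 : y + g * rW ≤ f) (h6 : f ≤ m)
    (h7 : 2 ^ rO * (sO + 1) ≤ 2 * m) (h8 : 1 ≤ rW + rO) (h9 : 1 ≤ sW + sO)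
    (h10 : 1 ≤ rW → y + h ≤ m) (hg : (h = 1 ∧ g = 1) ∨ (2 ≤ h ∧ g = 2)) :
    2 + sW + sO + 2 * rW + 2 * rO < 3 * m ∧
    (Odd m → 2 + sW + sO + 2 * rW + 2 * rO < 3 * m - 1) := by
  have hbig : 4 ≤ rO → 4 * rO * (sO + 1) ≤ 2 * m := by
    intro hr
    refine le_trans (Nat.mul_le_mul_right _ ?_) h7
    obtain ⟨c, rfl⟩ := Nat.exists_eq_add_of_le hr
    clear h7 h8 hr
    induction c with
    | zero => norm_num
    | succ c ih => rw [← add_assoc, pow_succ]; omega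
  rcases hg with ⟨rfl, rfl⟩ | ⟨hh, rfl⟩
  · rcases Nat.lt_or_ge rO 4 with hr | hr
    · interval_cases rO <;> refine ⟨by omega, ?_⟩ <;> rintro ⟨t, rfl⟩ <;> omega
    · have hb := hbig hr
      have : sO = 0 ∨ sO = 1 := by omega
      rcases this with rfl | rfl <;> omega
  · rcases Nat.lt_or_ge rO 4 with hr | hr
    · interval_cases rO <;> refine ⟨by omega, ?_⟩ <;> rintro ⟨t, rfl⟩ <;> omega
    · have hb := hbig hr
      have : 4 * (4 * sO) ≤ 4 * (rO * sO) := Nat.mul_le_mul_left _ (Nat.mul_le_mul_right _ hr)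
      have e : 4 * rO * (sO + 1) = 4 * (rO * sO) + 4 * rO := by ring
      omega

lemma r2_rot (hn : n = 2 * m) (hm : 2 ≤ m) {A B1 B2 : Multiset (ZMod n)}
    (h : IsMinimalProductOne (mk A (B1 + B2))) (hs : Sol A B1 B2) (hr : 2 ≤ B1.card)
    (hA : A ≠ 0) : A.card + 2 * B1.card < 3 * m ∧
      (Odd m → A.card + 2 * B1.card < 3 * m - 1) := by
  have hgood : ∃ b ∈ B1, ∃ d ∈ B2, (b - d) + (b - d) ≠ 0 := by
    by_contra hcon
    push Not at hcon
    have hB10 : B1 ≠ 0 := by rintro rfl; simp at hr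
    have hB20 : B2 ≠ 0 := by
      rintro rfl
      have := hs.1
      rw [this] at hr; simp at hr
    obtain ⟨d, hd⟩ := Multiset.exists_mem_of_ne_zero hB20
    obtain ⟨b, hb⟩ := Multiset.exists_mem_of_ne_zero hB10
    have hall : ∀ c ∈ B1, c = d + (m : ZMod n) := by
      intro c hc
      rcases dbl_zero hn (hcon c hc d hd) with h0 | h0
      · rw [sub_eq_zero] at h0
        subst h0
        exact (no_common h hs hr hc hd).elim
      · linear_combination h0
    obtain ⟨C1, rfl⟩ := Multiset.exists_cons_of_mem hb
    have : C1 ≠ 0 := by rintro rfl; simp at hr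
    obtain ⟨b', hb'⟩ := Multiset.exists_mem_of_ne_zero this
    obtain ⟨C1', rfl⟩ := Multiset.exists_cons_of_mem hb'
    obtain ⟨C2, rfl⟩ := Multiset.exists_cons_of_mem hd
    have : b' = b := by
      rw [hall b hb, hall b' (by simp)]
    subst this
    exact dup_opp h hs (hcon b' hb d hd)
  obtain ⟨b, hb, d, hd, hbd⟩ := hgood
  obtain ⟨C1, rfl⟩ := Multiset.exists_cons_of_mem hb
  obtain ⟨C2, rfl⟩ := Multiset.exists_cons_of_mem hd
  obtain ⟨P, rfl, rfl⟩ := exists_pairing (B1 := C1) (B2 := C2) (by simpa using hs.1)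
  have hs' : Sol A (((b, d) ::ₘ P).map Prod.fst) (((b, d) ::ₘ P).map Prod.snd) := by
    simpa using hs
  have hsz := hs'.sz
  have h' : IsMinimalProductOne (mk A (refl' ((b, d) ::ₘ P))) := by
    simpa [refl'] using h
  -- greedy
  set c0 : ZMod n × ZMod n := (b, d) with hc0
  obtain ⟨WA, OA, rfl, hA2, hA3⟩ := greedyD 1 (fun x => x) A {dl c0} (Or.inl rfl)
  rw [Multiset.map_id'] at hA2 hA3
  have hT0 : 2 ≤ (TT ({dl c0} : Multiset (ZMod n))).card := by
    have : ({0, dl c0 + dl c0} : Finset (ZMod n)) ⊆ TT ({dl c0} : Multiset (ZMod n)) := by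
      intro z hz
      rw [mem_TT]
      simp only [Finset.mem_insert, Finset.mem_singleton] at hz
      rcases hz with rfl | rfl
      · exact ⟨0, Multiset.zero_le _, by simp⟩
      · exact ⟨{dl c0}, le_rfl, by simp⟩
    refine le_trans ?_ (Finset.card_le_card this)
    rw [Finset.card_pair]
    exact fun h => hbd h.symm
  obtain ⟨g, hg⟩ : ∃ g : ℕ, ((stb (TT ({dl c0} + WA))).card = 1 ∧ g = 1) ∨
      (2 ≤ (stb (TT ({dl c0} + WA))).card ∧ g = 2) := by
    have := one_le_stb (X := {dl c0} + WA)
    rcases Nat.lt_or_ge (stb (TT ({dl c0} + WA))).card 2 with h | h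
    · exact ⟨1, Or.inl ⟨by omega, rfl⟩⟩
    · exact ⟨2, Or.inr ⟨h, rfl⟩⟩
  obtain ⟨WP, OP, rfl, hP2, hP3⟩ := greedyD g dl P ({dl c0} + WA) (by
    rcases hg with ⟨_, h⟩ | ⟨h1, h2⟩
    · exact Or.inl h
    · exact Or.inr ⟨h2, h1⟩)
  have e : {dl c0} + WA + WP.map dl = WA + (c0 ::ₘ WP).map dl := by
    rw [Multiset.map_cons, ← Multiset.singleton_add]; abel
  have hOA' : ∀ x ∈ OA, dbl x ∈ stb (TT (WA + (c0 ::ₘ WP).map dl)) := by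
    intro x hx
    rw [← e]
    exact stb_TT_mono (Multiset.le_add_right _ _) (hA3 x hx)
  have hOP' : ∀ p ∈ OP, dbl (dl p) ∈ stb (TT (WA + (c0 ::ₘ WP).map dl)) := by
    rw [← e]; exact hP3
  have hc := core (WA := WA) (OA := OA) (WP := c0 ::ₘ WP) (OP := OP)
    (by rw [Multiset.cons_add]; exact h') (by simp) (by rw [Multiset.cons_add]; exact hsz) hOA' hOP'
  have hb1 := bound_in hn hc.1 hc.2 hOA' hOP'
  have hb2 := bound_in hn (OP := 0) hc.1 (by
    intro D hD hD0; exact absurd (Multiset.le_zero.1 hD) hD0) hA3 (by simp)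
  rw [Multiset.card_zero, pow_zero, one_mul] at hb2
  have hk1 := card_stb_le (X := WA + (c0 ::ₘ WP).map dl)
  have hk2 := card_TT hn hm (WA + (c0 ::ₘ WP).map dl)
  have hA0 : 1 ≤ WA.card + OA.card := by
    rw [← Multiset.card_add]
    exact Multiset.card_pos.2 hA
  simp only [Multiset.card_cons, Multiset.card_map, Multiset.card_add] at hr ⊢
  have := arith_ii m WA.card OA.card WP.card OP.card (stb (TT ({dl c0} + WA))).card
    (TT ({dl c0} + WA)).card (TT (WA + (c0 ::ₘ WP).map dl)).card g hm (by omega) one_le_stb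
    card_stb_le hb2 (by rw [← e]; exact hP2) hk2 (by omega) (by omega) hA0 (by
      intro hrW
      apply card_TT_ne hn hm
      intro hE
      rw [hE] at hP2
      have h1 := Finset.card_le_card (TT_sub ({dl c0} + WA + WP.map dl))
      have h2 : 1 ≤ g * WP.card := Nat.mul_pos (by omega) hrW
      omega) hg
  refine ⟨by omega, fun ho => ?_⟩
  have := this.2 ho
  omega

end Two
end DihRho


namespace DihRho

section Pure
variable {n m : ℕ} [NeZero n]

lemma r2_pure_aux (hn : n = 2 * m) (hm : 2 ≤ m) {B1 B2 : Multiset (ZMod n)} {b : ZMod n}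
    (h : IsMinimalProductOne (mk 0 ((b ::ₘ b ::ₘ B1) + B2)))
    (hs : Sol 0 (b ::ₘ b ::ₘ B1) B2) (hr : 3 * m ≤ 2 * (B1.card + 2) + 1) : False := by
  have hcard := hs.1
  simp only [Multiset.card_cons] at hcard
  have hB1 : B1 ≠ 0 := by rintro rfl; simp at hr; omega
  have hnc : ∀ x, x ∈ b ::ₘ b ::ₘ B1 → x ∈ B2 → False := fun x h1 h2 =>
    no_common h hs (by simp) h1 h2
  -- choice of d
  have hd : ∃ d ∈ B2, ∀ x1 ∈ B1, ∀ y1 ∈ B2.erase d, (x1 - y1) + (x1 - y1) ≠ 0 := by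
    by_cases hex : ∃ x ∈ B1, ∃ y ∈ B2, (x - y) + (x - y) = 0
    · obtain ⟨x, hx, y, hy, hxy⟩ := hex
      refine ⟨y, hy, ?_⟩
      intro x1 hx1 y1 hy1 h11
      have hxy' : x = y + (m : ZMod n) := by
        rcases dbl_zero hn hxy with h0 | h0
        · rw [sub_eq_zero] at h0; subst h0
          exact (hnc x (by simp [hx]) hy).elim
        · linear_combination h0
      have hxy1 : x1 = y1 + (m : ZMod n) := by
        rcases dbl_zero hn h11 with h0 | h0
        · rw [sub_eq_zero] at h0; subst h0
          exact (hnc x1 (by simp [hx1]) (Multiset.mem_of_mem_erase hy1)).elim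
        · linear_combination h0
      obtain ⟨C1, rfl⟩ := Multiset.exists_cons_of_mem hx
      obtain ⟨C2, rfl⟩ := Multiset.exists_cons_of_mem hy
      rw [Multiset.erase_cons_head] at hy1
      obtain ⟨C2', rfl⟩ := Multiset.exists_cons_of_mem hy1
      rcases Multiset.mem_cons.1 hx1 with rfl | hx1
      · have hyy : y1 = y := by linear_combination hxy' - hxy1
        subst hyy
        have e : b ::ₘ b ::ₘ x1 ::ₘ C1 = x1 ::ₘ b ::ₘ b ::ₘ C1 := by
          simp only [← Multiset.singleton_add]; abel
        rw [e] at h hs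
        rw [add_comm] at h
        exact dup_opp h hs.symm (by linear_combination -hxy)
      · obtain ⟨C1', rfl⟩ := Multiset.exists_cons_of_mem hx1
        have e : b ::ₘ b ::ₘ x ::ₘ x1 ::ₘ C1' = x ::ₘ x1 ::ₘ b ::ₘ b ::ₘ C1' := by
          simp only [← Multiset.singleton_add]; abel
        rw [e] at h hs
        refine two_same h hs (by simp) ?_
        have := mu_add hn
        linear_combination hxy' + hxy1 + this
    · push Not at hex
      have : B2 ≠ 0 := by rintro rfl; simp at hcard
      obtain ⟨d, hd⟩ := Multiset.exists_mem_of_ne_zero this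
      exact ⟨d, hd, fun x1 hx1 y1 hy1 => hex x1 hx1 y1 (Multiset.mem_of_mem_erase hy1)⟩
  obtain ⟨d, hd, hpool⟩ := hd
  obtain ⟨C2, rfl⟩ := Multiset.exists_cons_of_mem hd
  rw [Multiset.erase_cons_head] at hpool
  have : C2 ≠ 0 := by rintro rfl; simp at hcard
  obtain ⟨e, he⟩ := Multiset.exists_mem_of_ne_zero this
  obtain ⟨C2, rfl⟩ := Multiset.exists_cons_of_mem he
  obtain ⟨Q, rfl, rfl⟩ := exists_pairing (B1 := B1) (B2 := C2) (by simpa using hcard)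
  obtain ⟨W, O, rfl, hW, hO⟩ := greedyD 1 dl Q 0 (Or.inl rfl)
  rw [zero_add] at hW hO
  have hT0 : 1 ≤ (TT (0 : Multiset (ZMod n))).card := Finset.card_pos.2 ⟨0, zero_mem_subs _⟩
  by_cases hE : TT (W.map dl) = EE n
  · -- split off {b,b}
    obtain ⟨-, A2, hA2, hsum⟩ := hs
    rw [Multiset.le_zero.1 hA2] at hsum
    have hsz : SZ (0 + ((d, e) ::ₘ (W + O)).map dl) := by
      rw [SZ_iff]
      have hle : W.map dl ≤ 0 + ((d, e) ::ₘ (W + O)).map dl := by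
        rw [zero_add]
        apply Multiset.map_le_map
        exact (Multiset.le_add_right _ _).trans (Multiset.le_cons_self _ _)
      refine subs_mono (Multiset.map_le_map hle) ?_
      change _ ∈ TT (W.map dl)
      rw [hE]
      refine Finset.mem_image.2 ⟨d - b, Finset.mem_univ _, ?_⟩
      rw [zero_add, sum_dl]
      simp only [Multiset.map_cons, Multiset.sum_cons, Multiset.sum_zero, zero_add, add_zero] at hsum ⊢
      unfold dbl
      linear_combination -hsum
    refine no_split (A := 0) (B := {b} + {b}) (A' := 0) (B' := refl' ((d, e) ::ₘ (W + O))) ?_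
      (po_double b) (po_pairs (by simp) hsz) (by simp) ?_
    · convert h using 2
      · simp
      · simp only [refl', Multiset.map_singleton, Multiset.map_add, ← Multiset.singleton_add]; abel
    · intro h0
      have := congrArg Multiset.card h0
      simp [card_refl'] at this
  · have h1 := card_TT_ne hn hm hE
    have hle : W.map dl ≤ 0 + ((b, d) ::ₘ (b, e) ::ₘ W).map dl := by
      rw [zero_add]
      apply Multiset.map_le_map
      exact (Multiset.le_cons_self _ _).trans (Multiset.le_cons_self _ _)
    have hc := core (WA := 0) (OA := 0) (WP := (b, d) ::ₘ (b, e) ::ₘ W) (OP := O) (by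
        convert h using 2
        · simp
        · simp only [refl', Multiset.map_singleton, Multiset.map_add, ← Multiset.singleton_add]; abel)
      (by simp) (by
        rw [zero_add]
        apply Sol.sz
        convert hs using 1 <;>
          simp only [Multiset.map_cons, Multiset.map_add, Multiset.cons_add])
      (by simp) (fun p hp => stb_TT_mono hle (hO p hp))
    have hb := bound_in hn hc.1 hc.2 (X := W.map dl) (by simp) hO
    have hk := card_stb_le (X := W.map dl)
    have hk1 := one_le_stb (X := W.map dl)
    simp only [Multiset.card_map, Multiset.card_add, Multiset.card_zero, zero_add, mul_one] at hr hb
    rcases Nat.lt_or_ge (stb (TT (W.map dl))).card 2 with hk2 | hk2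
    · have hO0 : O = 0 := by
        apply Multiset.eq_zero_of_forall_notMem
        intro p hp
        have h2 := hO p hp
        have h3 : dbl (dl p) = 0 := by
          have := Finset.card_le_one.1 (show (stb (TT (W.map dl))).card ≤ 1 by omega)
          exact this _ h2 _ (zero_mem_stb _)
        refine hpool p.1 ?_ p.2 ?_ h3
        · exact Multiset.mem_map_of_mem _ (Multiset.mem_add.2 (Or.inr hp))
        · exact Multiset.mem_cons_of_mem
            (Multiset.mem_map_of_mem _ (Multiset.mem_add.2 (Or.inr hp)))
      rw [hO0] at hr
      simp at hr
      omega
    · have hOk : O.card ≤ (stb (TT (W.map dl))).card := by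
        by_contra hcon
        have h2 : 2 ^ ((stb (TT (W.map dl))).card + 1) ≤ 2 ^ O.card :=
          Nat.pow_le_pow_right (by norm_num) (by omega)
        have h3 := Nat.lt_two_pow_self (n := (stb (TT (W.map dl))).card)
        rw [pow_succ] at h2
        omega
      omega

lemma r2_pure (hn : n = 2 * m) (hm : 2 ≤ m) {B1 B2 : Multiset (ZMod n)}
    (h : IsMinimalProductOne (mk 0 (B1 + B2))) (hs : Sol 0 B1 B2)
    (hr : 3 * m ≤ 2 * B1.card + 1) : False := by
  have hnd : ¬ (B1 + B2).Nodup := by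
    intro hnd
    have h1 := Finset.card_le_univ (⟨B1 + B2, hnd⟩ : Finset (ZMod n))
    rw [ZMod.card, Finset.card_mk, Multiset.card_add, ← hs.1] at h1
    omega
  rw [Multiset.nodup_iff_count_le_one] at hnd
  push Not at hnd
  obtain ⟨b, hb⟩ := hnd
  rw [Multiset.count_add] at hb
  have hone : B1.count b = 0 ∨ B2.count b = 0 := by
    by_contra hcon
    push Not at hcon
    exact no_common h hs (by omega) (Multiset.count_pos.1 (Nat.pos_of_ne_zero hcon.1))
      (Multiset.count_pos.1 (Nat.pos_of_ne_zero hcon.2))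
  have get : ∀ B : Multiset (ZMod n), 2 ≤ B.count b → ∃ C, B = b ::ₘ b ::ₘ C := by
    intro B hB
    have := Multiset.le_count_iff_replicate_le.1 hB
    obtain ⟨C, rfl⟩ := Multiset.le_iff_exists_add.1 this
    exact ⟨C, by simp [Multiset.replicate_succ]⟩
  rcases hone with h0 | h0
  · obtain ⟨C, rfl⟩ := get B2 (by omega)
    rw [add_comm] at h
    have h1 := hs.1
    simp only [Multiset.card_cons] at h1
    exact r2_pure_aux hn hm h hs.symm (by omega)
  · obtain ⟨C, rfl⟩ := get B1 (by omega)
    simp only [Multiset.card_cons] at hr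
    exact r2_pure_aux hn hm h hs (by omega)

/-- Structure of long atoms. -/
theorem atom_main (hn : n = 2 * m) (hm : 2 ≤ m) {A B : Multiset (ZMod n)}
    (h : IsMinimalProductOne (mk A B)) :
    A.card + B.card ≤ 3 * m ∧
    (A.card + B.card = 3 * m → ∃ g : ZMod n, g + g ≠ 0 ∧ A = Multiset.replicate (3 * m - 2) g) ∧
    (Odd m → A.card + B.card + 1 = 3 * m →
      A.card + 3 ≤ 3 * m ∧ ¬ ∀ x, A.count x = A.count (-x)) := by
  obtain ⟨B1, B2, rfl, hs⟩ := exists_sol h.2.1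
  have hc := hs.1
  rcases Nat.lt_trichotomy B1.card 1 with h0 | h1 | h2
  · have e1 : B1 = 0 := Multiset.card_eq_zero.1 (by omega)
    have e2 : B2 = 0 := Multiset.card_eq_zero.1 (by omega)
    subst e1 e2
    have := r0_bound (by simpa using h)
    simp only [add_zero, Multiset.card_zero]
    refine ⟨by omega, fun _ => by omega, fun ⟨t, ht⟩ _ => by omega⟩
  · obtain ⟨P, rfl, rfl⟩ := exists_pairing hc
    rw [Multiset.card_map, Multiset.card_eq_one] at h1
    obtain ⟨p, rfl⟩ := h1
    have hsz := hs.sz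
    have h' : IsMinimalProductOne (mk A (refl' {p})) := h
    obtain ⟨W, O, hWO, hZ, hW, hO⟩ := r1_main hn hm h' hsz
    have hAc : A.card = W.card + O.card := by rw [hWO]; simp
    simp only [Multiset.map_singleton, Multiset.card_add, Multiset.card_singleton]
    refine ⟨by omega, fun he => r1_U2 hn hm h' hsz (by omega), fun ⟨t, ht⟩ he => ⟨by omega, ?_⟩⟩
    exact fun hbal => r1_U3 hn (by omega) h' hsz (by omega) hbal
  · rw [Multiset.card_add, ← hc]
    by_cases hA : A = 0
    · subst hA
      have : ¬ (3 * m ≤ 2 * B1.card + 1) := fun hcon => r2_pure hn hm h hs hcon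
      simp only [Multiset.card_zero]
      refine ⟨by omega, fun _ => by omega, fun _ _ => by omega⟩
    · have := r2_rot hn hm h hs h2 hA
      refine ⟨by omega, fun _ => by omega, fun ho _ => ?_⟩
      have := this.2 ho
      omega

end Pure
end DihRho


namespace DihRho

section Weights

/-- additive weight -/
def phi {G : Type*} (F : G → ℤ) : Multiset G →+ ℤ where
  toFun S := (S.map F).sum
  map_zero' := by simp
  map_add' := by simp

lemma phi_apply {G : Type*} (F : G → ℤ) (S : Multiset G) : phi F S = (S.map F).sum := rfl

lemma phi_abs {G : Type*} (F : G → ℤ) (hF : ∀ g, |F g| ≤ 1) (S : Multiset G) :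
    |phi F S| ≤ S.card := by
  induction S using Multiset.induction_on with
  | empty => simp
  | cons a s ih =>
    rw [phi_apply, Multiset.map_cons, Multiset.sum_cons, Multiset.card_cons, ← phi_apply]
    have h1 := hF a
    rw [abs_le] at *
    push_cast
    omega

variable {G : Type*} [Group G] [DecidableEq G]

/-- the weight function -/
def wf (g : G) : ℤ := if g = 1 then 2 else 1

lemma phi_wf (S : Multiset G) : phi wf S = S.card + S.count 1 := by
  induction S using Multiset.induction_on with
  | empty => simp
  | cons a s ih =>
    rw [phi_apply, Multiset.map_cons, Multiset.sum_cons, Multiset.card_cons, ← phi_apply, ih,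
      Multiset.count_cons]
    by_cases h : a = 1
    · subst h; simp [wf]; ring
    · simp [wf, h, Ne.symm h]; ring

lemma atom_one {S : Multiset G} (h : IsMinimalProductOne S) (h1 : (1 : G) ∈ S) : S = {1} := by
  obtain ⟨-, ⟨l, rfl, hp⟩, hmin⟩ := h
  obtain ⟨s, t, rfl⟩ := List.append_of_mem (Multiset.mem_coe.1 h1)
  by_contra hne
  have e : ((s ++ 1 :: t : List G) : Multiset G) = {1} + ((s ++ t : List G) : Multiset G) := by
    rw [Multiset.singleton_add, Multiset.cons_coe, Multiset.coe_eq_coe]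
    exact List.perm_middle
  refine hmin {1} ((s ++ t : List G) : Multiset G) (by simp) ?_ ⟨[1], by simp, by simp⟩
    ⟨s ++ t, rfl, by simpa using hp⟩ e
  intro h0
  rw [e, h0] at hne
  simp at hne

lemma wt_ge {S : Multiset G} (h : IsMinimalProductOne S) : 2 ≤ phi wf S := by
  rw [phi_wf]
  by_cases h1 : (1 : G) ∈ S
  · rw [atom_one h h1]; simp
  · have h0 : S.card ≠ 0 := fun hc => h.1 (Multiset.card_eq_zero.1 hc)
    have h2 : S.card ≠ 1 := by
      intro hc
      obtain ⟨x, rfl⟩ := Multiset.card_eq_one.1 hc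
      obtain ⟨-, ⟨l, hl, hp⟩, -⟩ := h
      rw [Multiset.coe_eq_singleton] at hl
      subst hl
      simp at hp
      simp [hp] at h1
    omega

lemma wt_two {S : Multiset G} (h : IsMinimalProductOne S) (hw : phi wf S = 2) :
    S = {1} ∨ ∃ x, S = {x, x⁻¹} := by
  by_cases h1 : (1 : G) ∈ S
  · exact Or.inl (atom_one h h1)
  · right
    rw [phi_wf, Multiset.count_eq_zero.2 h1] at hw
    obtain ⟨-, ⟨l, rfl, hp⟩, -⟩ := h
    have hl : l.length = 2 := by
      have h3 : (l.length : ℤ) = 2 := by simpa using hw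
      exact_mod_cast h3
    obtain ⟨x, y, rfl⟩ := List.length_eq_two.1 hl
    simp at hp
    rw [← inv_eq_of_mul_eq_one_right hp]
    exact ⟨x, rfl⟩

lemma wt_card {S : Multiset G} (h : IsMinimalProductOne S) (hw : phi wf S ≠ 2) :
    phi wf S = S.card := by
  by_cases h1 : (1 : G) ∈ S
  · exfalso; apply hw; rw [atom_one h h1, phi_wf]; simp
  · rw [phi_wf, Multiset.count_eq_zero.2 h1]; simp

end Weights

section Upper
variable {n m : ℕ} [NeZero n]
open DihedralGroup

/-- extend a function on rotations by zero on reflections -/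
def FF (f : ZMod n → ℤ) : DihedralGroup n → ℤ
  | r x => f x
  | sr _ => 0

lemma phi_FF (f : ZMod n → ℤ) (A B : Multiset (ZMod n)) : phi (FF f) (mk A B) = (A.map f).sum := by
  rw [phi_apply, mk, Multiset.map_add, Multiset.map_map, Multiset.map_map, Multiset.sum_add]
  have e1 : FF f ∘ r = f := rfl
  have e2 : FF f ∘ sr = fun _ => 0 := rfl
  rw [e1, e2]
  simp

lemma FF_two (f : ZMod n → ℤ) (hf : ∀ x, f (-x) = - f x) {S : Multiset (DihedralGroup n)}
    (h : IsMinimalProductOne S) (hw : phi wf S = 2) : phi (FF f) S = 0 := by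
  have h0 : f 0 = 0 := by have := hf 0; simp at this; omega
  rcases wt_two h hw with rfl | ⟨x, rfl⟩
  · rw [phi_apply]; simp only [Multiset.map_singleton, Multiset.sum_singleton]
    rw [one_def]; exact h0
  · rw [phi_apply]
    cases x with
    | r i => simp [FF, hf]
    | sr i => simp [FF]

lemma FF_abs (f : ZMod n → ℤ) (hf : ∀ x, f (-x) = - f x) (hb : ∀ x, |f x| ≤ 1)
    {S : Multiset (DihedralGroup n)} (h : IsMinimalProductOne S) :
    |phi (FF f) S| ≤ 3 * (phi wf S - 2) := by
  by_cases hw : phi wf S = 2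
  · rw [FF_two f hf h hw, hw]; simp
  · have h1 := wt_card h hw
    have h2 := wt_ge h
    have h3 := phi_abs (FF f) (by rintro (x | x); exact hb x; simp [FF]) S
    omega

lemma wt_le (hn : n = 2 * m) (hm : 2 ≤ m) {S : Multiset (DihedralGroup n)}
    (h : IsMinimalProductOne S) : phi wf S ≤ 3 * m := by
  by_cases hw : phi wf S = 2
  · omega
  · rw [wt_card h hw]
    obtain ⟨A, B, rfl⟩ := exists_mk S
    have := (atom_main hn hm h).1
    rw [card_mk]
    omega

lemma wt_sum {k M : ℕ} {f : Fin k → Multiset (DihedralGroup n)}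
    {g : Fin M → Multiset (DihedralGroup n)} (F : DihedralGroup n → ℤ)
    (h : ∑ i, f i = ∑ j, g j) : ∑ i, phi F (f i) = ∑ j, phi F (g j) := by
  rw [← map_sum, ← map_sum, h]

lemma len_bound (hn : n = 2 * m) (hm : 2 ≤ m) {N M : ℕ} {a : Multiset (DihedralGroup n)}
    (h1 : HasLength a N) (h2 : HasLength a M) : 2 * M ≤ N * (3 * m) := by
  obtain ⟨f, hf, hfa⟩ := h1
  obtain ⟨g, hg, hga⟩ := h2
  have hs := wt_sum wf (hfa.trans hga.symm)
  have e1 : ∑ i, phi wf (f i) ≤ ∑ _i : Fin N, (3 * m : ℤ) :=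
    Finset.sum_le_sum fun i _ => wt_le hn hm (hf i)
  have e2 : ∑ _j : Fin M, (2 : ℤ) ≤ ∑ j, phi wf (g j) :=
    Finset.sum_le_sum fun i _ => wt_ge (hg i)
  simp at e1 e2
  zify
  linarith

/-- sign function -/
def sg (m : ℕ) (x : ZMod n) : ℤ :=
  if x + x = 0 then 0 else if x.val < m then 1 else -1

lemma sg_neg (hn : n = 2 * m) (x : ZMod n) : sg m (-x) = - sg m x := by
  unfold sg
  have e : (-x + -x = 0) ↔ (x + x = 0) := by
    rw [← neg_add, neg_eq_zero]
  by_cases h : x + x = 0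
  · rw [if_pos (e.2 h), if_pos h]; simp
  · rw [if_neg (fun hh => h (e.1 hh)), if_neg h]
    have hx0 : x ≠ 0 := by rintro rfl; simp at h
    have hv : (-x).val = n - x.val := by
      rw [ZMod.neg_val, if_neg hx0]
    have hne : x.val ≠ m := by
      intro hh
      apply h
      rw [← ZMod.natCast_zmod_val x, hh]
      exact mu_add hn
    have := ZMod.val_lt x
    rw [hv]
    split_ifs <;> first | omega | rfl | simp

theorem upper (hn : n = 2 * m) (hm : 2 ≤ m) {k M : ℕ} {a : Multiset (DihedralGroup n)}
    (h1 : HasLength a (2 * k + 1)) (h2 : HasLength a M) :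
    2 * M + 2 ≤ (2 * k + 1) * (3 * m) := by
  by_contra hcon
  have hbd := len_bound hn hm h1 h2
  obtain ⟨f, hf, hfa⟩ := h1
  obtain ⟨g, hg, hga⟩ := h2
  have hs := fun F => wt_sum F (hfa.trans hga.symm)
  have hu : ∀ i, 0 ≤ 3 * (m : ℤ) - phi wf (f i) := fun i => by
    have := wt_le hn hm (hf i); omega
  have hv : ∀ j, 0 ≤ phi wf (g j) - 2 := fun j => by
    have := wt_ge (hg j); omega
  have htot : ∑ i, (3 * (m : ℤ) - phi wf (f i)) + ∑ j, (phi wf (g j) - 2) =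
      (2 * k + 1) * (3 * m) - 2 * M := by
    rw [Finset.sum_sub_distrib, Finset.sum_sub_distrib, hs wf]
    simp
    ring
  have htot1 : ∑ i, (3 * (m : ℤ) - phi wf (f i)) + ∑ j, (phi wf (g j) - 2) ≤ 1 := by
    rw [htot]
    zify at hcon
    linarith
  have hU : 0 ≤ ∑ i, (3 * (m : ℤ) - phi wf (f i)) := Finset.sum_nonneg fun i _ => hu i
  have hV : 0 ≤ ∑ j, (phi wf (g j) - 2) := Finset.sum_nonneg fun i _ => hv i
  -- structure of full atoms
  have hfull : ∀ i, phi wf (f i) = 3 * m → ∃ c : ZMod n, c + c ≠ 0 ∧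
      ∀ F : ZMod n → ℤ, phi (FF F) (f i) = (3 * m - 2) * F c := by
    intro i hi
    have hc := wt_card (hf i) (by omega)
    obtain ⟨A, B, hAB⟩ := exists_mk (f i)
    have hat := hf i
    rw [hAB] at hat
    rw [hAB, card_mk, ← hAB] at hc
    obtain ⟨c, hc0, hA⟩ := (atom_main hn hm hat).2.1 (by omega)
    refine ⟨c, hc0, fun F => ?_⟩
    rw [hAB, phi_FF, hA, Multiset.map_replicate, Multiset.sum_replicate]
    rw [nsmul_eq_mul, Nat.cast_sub (by omega)]
    push_cast
    ring
  by_cases hall : ∀ i, phi wf (f i) = 3 * m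
  · choose c hc0 hc using fun i => hfull i (hall i)
    have hS := hs (FF (sg m))
    have hodd : ∀ i, ∃ t : ℤ, sg m (c i) = 2 * t + 1 := by
      intro i
      unfold sg
      rw [if_neg (hc0 i)]
      split_ifs
      · exact ⟨0, by ring⟩
      · exact ⟨-1, by ring⟩
    choose t ht using hodd
    have hL : ∑ i, phi (FF (sg m)) (f i) = (3 * m - 2) * (2 * (∑ i, t i + k) + 1) := by
      have : ∀ i, phi (FF (sg m)) (f i) = (3 * m - 2) * (2 * t i + 1) := fun i => by
        rw [hc i, ht i]
      simp only [this]
      rw [← Finset.mul_sum, Finset.sum_add_distrib, ← Finset.mul_sum]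
      simp
      left; ring
    have hR : |∑ j, phi (FF (sg m)) (g j)| ≤ 3 * ∑ j, (phi wf (g j) - 2) := by
      refine (Finset.abs_sum_le_sum_abs _ _).trans ?_
      rw [Finset.mul_sum]
      refine Finset.sum_le_sum fun j _ => FF_abs (sg m) (sg_neg hn) ?_ (hg j)
      intro x; unfold sg; split_ifs <;> simp
    rw [← hS, hL, abs_le] at hR
    have hx : (∑ i, t i + k : ℤ) ≥ 0 ∨ (∑ i, t i + k : ℤ) ≤ -1 := by omega
    rcases hx with hx | hx
    · nlinarith
    · nlinarith
  · push Not at hall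
    obtain ⟨i0, hi0⟩ := hall
    have hsplit := Finset.add_sum_erase Finset.univ (fun i => 3 * (m : ℤ) - phi wf (f i))
      (Finset.mem_univ i0)
    have hE : 0 ≤ ∑ i ∈ Finset.univ.erase i0, (3 * (m : ℤ) - phi wf (f i)) :=
      Finset.sum_nonneg fun i _ => hu i
    have hu0 := hu i0
    have hE0 : ∑ i ∈ Finset.univ.erase i0, (3 * (m : ℤ) - phi wf (f i)) = 0 := by omega
    have hV0 : ∑ j, (phi wf (g j) - 2) = 0 := by omega
    have hi1 : phi wf (f i0) + 1 = 3 * m := by omega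
    rw [Finset.sum_eq_zero_iff_of_nonneg fun i _ => hu i] at hE0
    rw [Finset.sum_eq_zero_iff_of_nonneg fun i _ => hv i] at hV0
    have hodd : Odd m := by
      have h1 : ((2 * k + 1) * (3 * m) : ℤ) - 2 * M = 1 := by rw [← htot]; omega
      have h2 : (2 * k + 1) * (3 * m) = 2 * M + 1 := by zify; linarith
      have h3 : Odd ((2 * k + 1) * (3 * m)) := ⟨M, h2⟩
      rw [Nat.odd_mul, Nat.odd_mul] at h3
      exact h3.2.2
    have hc := wt_card (hf i0) (by omega)
    obtain ⟨A, B, hAB⟩ := exists_mk (f i0)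
    have hat := hf i0
    rw [hAB] at hat
    rw [hAB, card_mk, ← hAB] at hc
    obtain ⟨hA3, hnb⟩ := (atom_main hn hm hat).2.2 hodd (by omega)
    apply hnb
    intro x
    set F : ZMod n → ℤ := fun y => (if y = x then 1 else 0) - (if y = -x then 1 else 0) with hF
    have hFodd : ∀ y, F (-y) = - F y := by
      intro y
      simp only [hF, neg_inj, neg_eq_iff_eq_neg]
      ring
    have hSum := hs (FF F)
    rw [Finset.sum_eq_zero (fun j _ => FF_two F hFodd (hg j) (by
      have := hV0 j (Finset.mem_univ j); omega))] at hSum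
    rw [← Finset.add_sum_erase Finset.univ _ (Finset.mem_univ i0)] at hSum
    have hdvd : (3 * m - 2 : ℤ) ∣ ∑ i ∈ Finset.univ.erase i0, phi (FF F) (f i) := by
      apply Finset.dvd_sum
      intro i hi
      obtain ⟨c, -, hc⟩ := hfull i (by have := hE0 i hi; omega)
      exact ⟨F c, hc F⟩
    have hval : phi (FF F) (f i0) = (A.count x : ℤ) - A.count (-x) := by
      rw [hAB, phi_FF, hF]
      rw [Multiset.sum_map_sub]
      congr 1 <;>
      · clear hAB hat hc hA3 hnb
        induction A using Multiset.induction_on with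
        | empty => simp
        | cons a s ih =>
          rw [Multiset.map_cons, Multiset.sum_cons, ih, Multiset.count_cons]
          simp only [eq_comm]
          push_cast
          ring
    have hdvd2 : (3 * m - 2 : ℤ) ∣ (A.count x : ℤ) - A.count (-x) := by
      rw [← hval]
      have : phi (FF F) (f i0) = - ∑ i ∈ Finset.univ.erase i0, phi (FF F) (f i) := by linarith
      rw [this]
      exact (dvd_neg).2 hdvd
    have hz := Int.eq_zero_of_abs_lt_dvd hdvd2 (by
      have e1 := Multiset.count_le_card x A
      have e2 := Multiset.count_le_card (-x) A
      rw [abs_lt]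
      omega)
    omega

end Upper
end DihRho


namespace DihRho

section Lengths
variable {G H : Type*} [Group G] [Group H]

lemma hasLength_zero : HasLength (0 : Multiset G) 0 := ⟨fun i => i.elim0, fun i => i.elim0, by simp⟩

lemma hasLength_one {S : Multiset G} (h : IsMinimalProductOne S) : HasLength S 1 :=
  ⟨fun _ => S, fun _ => h, by simp⟩

lemma hasLength_add {a b : Multiset G} {k l : ℕ} (h1 : HasLength a k) (h2 : HasLength b l) :
    HasLength (a + b) (k + l) := by
  obtain ⟨f, hf, rfl⟩ := h1
  obtain ⟨g, hg, rfl⟩ := h2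
  refine ⟨Fin.append f g, ?_, ?_⟩
  · intro i
    refine Fin.addCases (fun i => ?_) (fun i => ?_) i
    · rw [Fin.append_left]; exact hf i
    · rw [Fin.append_right]; exact hg i
  · rw [Fin.sum_univ_add]
    simp only [Fin.append_left, Fin.append_right]

lemma hasLength_nsmul {a : Multiset G} {k : ℕ} (c : ℕ) (h : HasLength a k) :
    HasLength (c • a) (c * k) := by
  induction c with
  | zero => simpa using hasLength_zero
  | succ c ih =>
    rw [succ_nsmul, Nat.succ_mul]
    exact hasLength_add ih h

lemma hasLength_po {a : Multiset G} {k : ℕ} (h : HasLength a k) : IsProductOne a := by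
  obtain ⟨f, hf, rfl⟩ := h
  refine Finset.sum_induction _ IsProductOne (fun a b h1 h2 => po_add h1 h2) ⟨[], by simp, by simp⟩
    (fun i _ => (hf i).2.1)

lemma pair_atom {x : G} (hx : x ≠ 1) : IsMinimalProductOne ({x} + {x⁻¹} : Multiset G) := by
  refine ⟨by simp, ⟨[x, x⁻¹], rfl, by simp⟩, ?_⟩
  intro T1 T2 h1 h2 hp1 hp2 he
  have hc := congrArg Multiset.card he
  rw [Multiset.card_add, Multiset.card_add, Multiset.card_singleton, Multiset.card_singleton] at hc
  have c1 := Multiset.card_pos.2 h1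
  have c2 := Multiset.card_pos.2 h2
  obtain ⟨y, rfl⟩ := Multiset.card_eq_one.1 (show T1.card = 1 by omega)
  have hy : y ∈ ({x} + {x⁻¹} : Multiset G) := by rw [he]; simp
  obtain ⟨l, hl, hp⟩ := hp1
  rw [Multiset.coe_eq_singleton] at hl
  subst hl
  have hy1 : y = 1 := by simpa using hp
  subst hy1
  simp at hy
  rcases hy with h | h
  · exact hx h.symm
  · exact hx h

lemma po_map (e : G ≃* H) {S : Multiset G} (h : IsProductOne S) : IsProductOne (S.map e) := by
  obtain ⟨l, rfl, hp⟩ := h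
  refine ⟨l.map e, by simp, ?_⟩
  rw [← map_list_prod, hp, map_one]

lemma map_symm (e : G ≃* H) (S : Multiset H) : (S.map e.symm).map e = S := by
  simp [Multiset.map_map]

lemma atom_map (e : G ≃* H) {S : Multiset G} (h : IsMinimalProductOne S) :
    IsMinimalProductOne (S.map e) := by
  obtain ⟨h0, hp, hmin⟩ := h
  refine ⟨by simpa using h0, po_map e hp, ?_⟩
  intro T1 T2 h1 h2 hp1 hp2 he
  refine hmin (T1.map e.symm) (T2.map e.symm) (by simpa using h1) (by simpa using h2)
    (po_map e.symm hp1) (po_map e.symm hp2) ?_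
  rw [← Multiset.map_add, ← he]
  exact (map_symm e.symm S).symm

lemma hasLength_map (e : G ≃* H) {a : Multiset G} {k : ℕ} (h : HasLength a k) :
    HasLength (a.map e) k := by
  obtain ⟨f, hf, rfl⟩ := h
  refine ⟨fun i => (f i).map e, fun i => atom_map e (hf i), ?_⟩
  exact (map_sum (Multiset.mapAddMonoidHom (e : G → H)) f Finset.univ).symm

lemma davenport_congr (e : G ≃* H) : DavenportLarge G = DavenportLarge H := by
  unfold DavenportLarge
  congr 1
  ext k
  constructor
  · rintro ⟨S, h, rfl⟩; exact ⟨S.map e, atom_map e h, by simp⟩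
  · rintro ⟨S, h, rfl⟩; exact ⟨S.map e.symm, atom_map e.symm h, by simp⟩

lemma rho_congr (e : G ≃* H) (k : ℕ) : rhoK G k = rhoK H k := by
  unfold rhoK UnionLengths
  congr 1
  ext M
  constructor
  · rintro ⟨a, h1, h2, h3⟩
    exact ⟨a.map e, po_map e h1, hasLength_map e h2, hasLength_map e h3⟩
  · rintro ⟨a, h1, h2, h3⟩
    exact ⟨a.map e.symm, po_map e.symm h1, hasLength_map e.symm h2, hasLength_map e.symm h3⟩

end Lengths

section Lower
variable {n m : ℕ} [NeZero n]
open DihedralGroup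

lemma nat_cast_lt_eq {n : ℕ} {a b : ℕ} (ha : a < n) (hb : b < n)
    (h : (a : ZMod n) = (b : ZMod n)) : a = b := by
  rw [ZMod.natCast_eq_natCast_iff] at h
  exact Nat.ModEq.eq_of_lt_of_lt h ha hb

lemma pm_mul (hn : n = 2 * m) {g : ZMod n} (hg : g = 1 ∨ g = -1) :
    g * g = 1 ∧ (m : ZMod n) * g = m := by
  have := mu_add hn
  rcases hg with rfl | rfl
  · simp
  · refine ⟨by simp, by linear_combination -this⟩

lemma le_replicate {X : Multiset (ZMod n)} {N : ℕ} {g : ZMod n} (h : X ≤ Multiset.replicate N g) :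
    X = Multiset.replicate X.card g :=
  Multiset.eq_replicate.2 ⟨rfl, fun _ hb => Multiset.eq_of_mem_replicate (Multiset.mem_of_le h hb)⟩

lemma even_refl {A B : Multiset (ZMod n)} (h : IsProductOne (mk A B)) : Even B.card := by
  obtain ⟨A1, A2, B1, B2, -, rfl, hc, -⟩ := po_elim h
  rw [Multiset.card_add, hc]
  exact ⟨_, rfl⟩

lemma U_aux (hn : n = 2 * m) (hm : 2 ≤ m) {g b : ZMod n} (hg : g = 1 ∨ g = -1)
    {X Y B : Multiset (ZMod n)} (hXY : X + Y = Multiset.replicate (3 * m - 2) g)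
    (hB : B = b ::ₘ {b + (m : ZMod n)}) (h1 : IsProductOne (mk X 0)) (hX : X ≠ 0)
    (h2 : IsProductOne (mk Y B)) : False := by
  obtain ⟨hgg, hmg⟩ := pm_mul hn hg
  have hXr := le_replicate (hXY ▸ Multiset.le_add_right X Y)
  have hYr := le_replicate (hXY ▸ Multiset.le_add_left Y X)
  have hc := congrArg Multiset.card hXY
  rw [Multiset.card_add, Multiset.card_replicate] at hc
  have hXs := po_rot_iff.1 h1
  rw [hXr, Multiset.sum_replicate, nsmul_eq_mul] at hXs
  have hX0 : ((X.card : ℕ) : ZMod n) = 0 := by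
    linear_combination g * hXs - (X.card : ZMod n) * hgg
  rw [ZMod.natCast_eq_zero_iff] at hX0
  have hXle := Nat.le_of_dvd (Multiset.card_pos.2 hX) hX0
  obtain ⟨Y1, Y2, B1, B2, hY, hBB, hcB, hsum, -⟩ := po_elim h2
  have hY1 := le_replicate (hYr ▸ hY ▸ Multiset.le_add_right Y1 Y2 : Y1 ≤ _)
  have hY2 := le_replicate (hYr ▸ hY ▸ Multiset.le_add_left Y2 Y1 : Y2 ≤ _)
  have hYc := congrArg Multiset.card hY
  rw [Multiset.card_add] at hYc
  have hBc := congrArg Multiset.card hBB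
  rw [hB, Multiset.card_add, Multiset.card_cons, Multiset.card_singleton] at hBc
  obtain ⟨x, rfl⟩ := Multiset.card_eq_one.1 (show B1.card = 1 by omega)
  obtain ⟨y, rfl⟩ := Multiset.card_eq_one.1 (show B2.card = 1 by omega)
  have hy : y ∈ b ::ₘ {b + (m : ZMod n)} := by rw [← hB, hBB]; simp
  have hxy : x + y = b + (b + (m : ZMod n)) := by
    have := congrArg Multiset.sum hBB
    rw [hB] at this
    simpa using this.symm
  have hmu := mu_add hn
  have hdiff : x - y = m := by
    simp at hy
    rcases hy with rfl | rfl
    · linear_combination hxy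
    · linear_combination hxy - hmu
  rw [hY1, hY2, Multiset.sum_replicate, Multiset.sum_replicate, nsmul_eq_mul, nsmul_eq_mul,
    Multiset.sum_singleton, Multiset.sum_singleton, hdiff] at hsum
  have hkey : ((Y1.card + m : ℕ) : ZMod n) = (Y2.card : ℕ) := by
    push_cast
    linear_combination g * hsum - ((Y1.card : ZMod n) - Y2.card) * hgg - hmg
  have := nat_cast_lt_eq (by omega) (by omega) hkey
  omega

lemma U_atom (hn : n = 2 * m) (hm : 2 ≤ m) {g b : ZMod n} (hg : g = 1 ∨ g = -1) :
    IsMinimalProductOne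
      (mk (Multiset.replicate (3 * m - 2) g) (b ::ₘ {b + (m : ZMod n)})) := by
  obtain ⟨hgg, hmg⟩ := pm_mul hn hg
  refine ⟨by rw [Ne, mk_eq_zero]; simp, ?_, ?_⟩
  · have e : mk (Multiset.replicate (3 * m - 2) g) (b ::ₘ {b + (m : ZMod n)}) =
        mk (Multiset.replicate (2 * m - 1) g + Multiset.replicate (m - 1) g)
          ({b} + {b + (m : ZMod n)}) := by
      rw [← Multiset.replicate_add, Multiset.singleton_add]
      congr 2; omega
    rw [e]
    refine po_of (by simp) (by simp) ?_
    rw [Multiset.sum_replicate, Multiset.sum_replicate, nsmul_eq_mul, nsmul_eq_mul,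
      Multiset.sum_singleton, Multiset.sum_singleton, Nat.cast_sub (by omega),
      Nat.cast_sub (by omega)]
    push_cast
    linear_combination hmg
  · intro T1 T2 h1 h2 hp1 hp2 he
    obtain ⟨X, C, rfl⟩ := exists_mk T1
    obtain ⟨Y, D, rfl⟩ := exists_mk T2
    rw [← mk_add] at he
    obtain ⟨hXY, hCD⟩ := mk_inj he
    have e1 := even_refl hp1
    have e2 := even_refl hp2
    have hc := congrArg Multiset.card hCD
    rw [Multiset.card_add, Multiset.card_cons, Multiset.card_singleton] at hc
    obtain ⟨s, hs⟩ := e1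
    obtain ⟨t, ht⟩ := e2
    have : C.card = 0 ∨ D.card = 0 := by omega
    rcases this with h0 | h0
    · rw [Multiset.card_eq_zero] at h0
      subst h0
      refine U_aux hn hm hg hXY.symm (by rw [hCD, zero_add]) hp1 ?_ hp2
      rintro rfl; exact h1 (by simp [mk])
    · rw [Multiset.card_eq_zero] at h0
      subst h0
      refine U_aux hn hm hg (by rw [add_comm]; exact hXY.symm) (by rw [hCD, add_zero]) hp2 ?_ hp1
      rintro rfl; exact h2 (by simp [mk])

lemma V_atom (hn : n = 2 * m) (hm : 2 ≤ m) :
    IsMinimalProductOne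
      (mk 0 (0 ::ₘ (m : ZMod n) ::ₘ 1 ::ₘ {1 + (m : ZMod n)})) := by
  have hmu := mu_add hn
  have hmu0 := mu_ne hn hm
  have h10 : (1 : ZMod n) ≠ 0 := by
    intro h
    have := nat_cast_lt_eq (n := n) (a := 1) (b := 0) (by omega) (by omega) (by simpa using h)
    omega
  have hm1 : (m : ZMod n) ≠ 1 := by
    intro h
    have := nat_cast_lt_eq (n := n) (a := m) (b := 1) (by omega) (by omega) (by simpa using h)
    omega
  have hm10 : 1 + (m : ZMod n) ≠ 0 := by
    intro h
    have := nat_cast_lt_eq (n := n) (a := 1 + m) (b := 0) (by omega) (by omega) (by simpa using h)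
    omega
  have hnd : (0 ::ₘ (m : ZMod n) ::ₘ 1 ::ₘ {1 + (m : ZMod n)}).Nodup := by
    simp [hmu0, hmu0.symm, h10, h10.symm, hm1, hm10.symm]
  refine ⟨by rw [Ne, mk_eq_zero]; simp, ?_, ?_⟩
  · have e : mk 0 (0 ::ₘ (m : ZMod n) ::ₘ 1 ::ₘ {1 + (m : ZMod n)}) =
        mk (0 + 0) ((0 ::ₘ {1 + (m : ZMod n)}) + ((m : ZMod n) ::ₘ {1})) := by
      congr 1
      simp only [← Multiset.singleton_add]; abel
    rw [e]
    refine po_of (by simp) (by simp) ?_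
    simp
    ring
  · intro T1 T2 h1 h2 hp1 hp2 he
    obtain ⟨X, C, rfl⟩ := exists_mk T1
    obtain ⟨Y, D, rfl⟩ := exists_mk T2
    rw [← mk_add] at he
    obtain ⟨hXY, hCD⟩ := mk_inj he
    have hX0 : X = 0 ∧ Y = 0 := by
      have := hXY.symm; simpa using this
    obtain ⟨rfl, rfl⟩ := hX0
    have e1 := even_refl hp1
    have e2 := even_refl hp2
    have hc := congrArg Multiset.card hCD
    rw [Multiset.card_add] at hc
    simp only [Multiset.card_cons, Multiset.card_singleton] at hc
    have hC0 : C.card ≠ 0 := by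
      intro h
      rw [Multiset.card_eq_zero] at h
      subst h; exact h1 (by simp [mk])
    have hD0 : D.card ≠ 0 := by
      intro h
      rw [Multiset.card_eq_zero] at h
      subst h; exact h2 (by simp [mk])
    obtain ⟨s, hs⟩ := e1
    obtain ⟨t, ht⟩ := e2
    obtain ⟨A1, A2, B1, B2, hA, rfl, hcB, hsum, -⟩ := po_elim hp1
    have hcc := Multiset.card_add B1 B2
    have hB1 : B1.card = 1 := by omega
    have hB2 : B2.card = 1 := by omega
    obtain ⟨x, rfl⟩ := Multiset.card_eq_one.1 hB1
    obtain ⟨y, rfl⟩ := Multiset.card_eq_one.1 hB2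
    have hA0 : A1 = 0 ∧ A2 = 0 := by
      have := hA.symm; simpa using this
    obtain ⟨rfl, rfl⟩ := hA0
    have hxy : x = y := by
      simp at hsum
      exact sub_eq_zero.1 hsum
    subst hxy
    rw [hCD] at hnd
    have := Multiset.nodup_of_le (Multiset.le_add_right _ _) hnd
    simp at this

lemma mk_rep (N : ℕ) (g : ZMod n) (B : Multiset (ZMod n)) :
    mk (Multiset.replicate N g) B = N • {r g} + B.map sr := by
  rw [mk, Multiset.map_replicate, Multiset.nsmul_singleton]

lemma sr_ne (i : ZMod n) : sr i ≠ (1 : DihedralGroup n) := by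
  rw [one_def]; intro h; cases h

lemma sr_pair (i : ZMod n) : HasLength ({sr i} + {sr i} : Multiset (DihedralGroup n)) 1 := by
  have := pair_atom (sr_ne i)
  rw [inv_sr] at this
  exact hasLength_one this

lemma lower (hn : n = 2 * m) (hm : 2 ≤ m) (k : ℕ) (hk : 1 ≤ k) :
    k * (3 * m) + 2 ∈ UnionLengths (DihedralGroup n) (2 * k + 1) := by
  have h10 : (1 : ZMod n) ≠ 0 := by
    intro h
    have := nat_cast_lt_eq (n := n) (a := 1) (b := 0) (by omega) (by omega) (by simpa using h)
    omega
  set U1 := mk (Multiset.replicate (3 * m - 2) (1 : ZMod n)) (0 ::ₘ {0 + (m : ZMod n)}) with hU1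
  set U2 := mk (Multiset.replicate (3 * m - 2) (-1 : ZMod n)) (0 ::ₘ {0 + (m : ZMod n)}) with hU2
  set U3 := mk (Multiset.replicate (3 * m - 2) (-1 : ZMod n)) (1 ::ₘ {1 + (m : ZMod n)}) with hU3
  set V := mk (0 : Multiset (ZMod n)) (0 ::ₘ (m : ZMod n) ::ₘ 1 ::ₘ {1 + (m : ZMod n)}) with hV
  have a1 : HasLength U1 1 := hasLength_one (U_atom hn hm (Or.inl rfl))
  have a2 : HasLength U2 1 := hasLength_one (U_atom hn hm (Or.inr rfl))
  have a3 : HasLength U3 1 := hasLength_one (U_atom hn hm (Or.inr rfl))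
  have a4 : HasLength V 1 := hasLength_one (V_atom hn hm)
  have hrot : HasLength ({r 1} + {r (-1)} : Multiset (DihedralGroup n)) 1 := by
    have := pair_atom (x := (r 1 : DihedralGroup n)) (by
      rw [one_def]; intro h; exact h10 (r.inj h))
    rw [inv_r] at this
    exact hasLength_one this
  have hL : HasLength ((k - 1) • (U1 + U2) + (U1 + U3 + V)) (2 * k + 1) := by
    have := hasLength_add (hasLength_nsmul (k - 1) (hasLength_add a1 a2))
      (hasLength_add (hasLength_add a1 a3) a4)
    convert this using 1
    omega
  have p1 : HasLength (U1 + U2) (3 * m) := by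
    have := hasLength_add (hasLength_nsmul (3 * m - 2) hrot)
      (hasLength_add (sr_pair (0 : ZMod n)) (sr_pair (0 + (m : ZMod n))))
    convert this using 1
    · rw [hU1, hU2, mk_rep, mk_rep, nsmul_add]
      simp only [Multiset.map_add, Multiset.map_singleton, ← Multiset.singleton_add]
      abel
    · omega
  have p2 : HasLength (U1 + U3 + V) (3 * m + 2) := by
    have := hasLength_add (hasLength_nsmul (3 * m - 2) hrot)
      (hasLength_add (hasLength_add (sr_pair (0 : ZMod n)) (sr_pair (m : ZMod n)))
        (hasLength_add (sr_pair (1 : ZMod n)) (sr_pair (1 + (m : ZMod n)))))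
    convert this using 1
    · rw [hU1, hU3, hV, mk_rep, mk_rep, mk, nsmul_add]
      simp only [Multiset.map_add, Multiset.map_singleton, ← Multiset.singleton_add, zero_add,
        Multiset.map_zero]
      abel
    · omega
  refine ⟨_, hasLength_po hL, hL, ?_⟩
  have := hasLength_add (hasLength_nsmul (k - 1) p1) p2
  convert this using 1
  obtain ⟨j, rfl⟩ := Nat.exists_eq_add_of_le hk
  rw [Nat.add_sub_cancel_left]
  ring

lemma davenport_eq (hn : n = 2 * m) (hm : 2 ≤ m) : DavenportLarge (DihedralGroup n) = 3 * m := by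
  apply IsGreatest.csSup_eq
  constructor
  · refine ⟨_, U_atom hn hm (g := 1) (b := 0) (Or.inl rfl), ?_⟩
    rw [card_mk]
    simp
    omega
  · rintro _ ⟨S, h, rfl⟩
    obtain ⟨A, B, rfl⟩ := exists_mk S
    rw [card_mk]
    exact (atom_main hn hm h).1

end Lower
end DihRho

theorem rho_odd_bounds_dihedral_even
    (n : ℕ) (hn : 4 ≤ n) (heven : Even n)
    (G : Type*) [Group G] (hG : Nonempty (G ≃* DihedralGroup n))
    (k : ℕ) (hk : 1 ≤ k) :
    k * DavenportLarge G + 2 ≤ rhoK G (2 * k + 1) ∧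
      rhoK G (2 * k + 1) ≤ (2 * k + 1) * DavenportLarge G / 2 - 1 := by
  obtain ⟨e⟩ := hG
  obtain ⟨m, hm⟩ := heven
  have hn2 : n = 2 * m := by omega
  have hm2 : 2 ≤ m := by omega
  haveI : NeZero n := ⟨by omega⟩
  rw [DihRho.davenport_congr e, DihRho.rho_congr e, DihRho.davenport_eq hn2 hm2]
  have hlow := DihRho.lower hn2 hm2 k hk
  constructor
  · refine le_csSup ⟨(2 * k + 1) * (3 * m), ?_⟩ hlow
    rintro M ⟨a, -, h1, h2⟩
    have := DihRho.upper hn2 hm2 h1 h2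
    omega
  · refine csSup_le ⟨_, hlow⟩ ?_
    rintro M ⟨a, -, h1, h2⟩
    have := DihRho.upper hn2 hm2 h1 h2
    omega
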